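/- Let n ≥ 2, let M be a connected n-manifold without boundary, let X be a closed subset of M with X ≠ M, and let μ be a good Radon measure on M. Then the space 𝓗_X(M;μ)₀ (with the subspace topology inherited from C(M,M)) is not locally compact. -/

import Mathlib

open MeasureTheory TopologicalSpace

/-- The set of `μ`-preserving homeomorphisms of `M` fixing `X` pointwise,
as a subset of `C(M, M)` (compact-open topology). -/
def MPHomeoFixSet (M : Type*) [TopologicalSpace M] [MeasurableSpace M]
    (X : Set M) (μ : Measure M) : Set C(M, M) :=
  {f | IsHomeomorph f ∧ (∀ x ∈ X, f x = x) ∧ Measure.map f μ = μ}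

/-- The identity component `𝓗_X(M;μ)₀`. -/
def MPHomeoFixIdComp (M : Type*) [TopologicalSpace M] [MeasurableSpace M]
    (X : Set M) (μ : Measure M) : Set C(M, M) :=
  connectedComponentIn (MPHomeoFixSet M X μ) (ContinuousMap.id M)

open Set Filter Topology Function

section Quantile

/-- A finite atomless measure on the line attains every intermediate value on a lower half-line. -/
theorem exists_measure_Iic_eq (κ : Measure ℝ) [IsFiniteMeasure κ] (hκ : ∀ s, κ {s} = 0)
    {α : ENNReal} (h0 : 0 < α) (h1 : α < κ univ) : ∃ s, κ (Iic s) = α := by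
  have hbot : Tendsto (fun k : ℕ => κ (Iic (-(k : ℝ)))) atTop (𝓝 0) := by
    have h : ⋂ k : ℕ, Iic (-(k : ℝ)) = ∅ := by
      refine eq_empty_of_forall_notMem fun x hx => ?_
      obtain ⟨k, hk⟩ := exists_nat_gt (-x)
      have : x ≤ -(k : ℝ) := mem_iInter.1 hx k
      linarith
    rw [← measure_empty (μ := κ), ← h]
    refine tendsto_measure_iInter_atTop (fun _ => measurableSet_Iic.nullMeasurableSet)
      (fun i j hij => Iic_subset_Iic.2 ?_) ⟨0, measure_ne_top _ _⟩
    simpa using hij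
  have htop := tendsto_measure_Iic_atTop κ
  obtain ⟨k, hl⟩ := (hbot.eventually (gt_mem_nhds h0)).exists
  obtain ⟨u, hu⟩ := (htop.eventually (lt_mem_nhds h1)).exists
  have hmono : Monotone fun s => κ (Iic s) := fun s t h => measure_mono (Iic_subset_Iic.2 h)
  set S : Set ℝ := {s | κ (Iic s) < α}
  have hSne : S.Nonempty := ⟨_, hl⟩
  have hSbdd : BddAbove S := ⟨u, fun s hs => by
    by_contra hlt
    exact absurd (hmono (not_le.1 hlt).le) (not_le.2 (lt_trans hs hu))⟩
  refine ⟨sSup S, le_antisymm ?_ ?_⟩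
  · have hIio : κ (Iic (sSup S)) ≤ κ (Iio (sSup S)) := by
      rw [← Iio_union_right]
      exact (measure_union_le _ _).trans (by rw [hκ, add_zero])
    refine hIio.trans ?_
    obtain ⟨v, hvm, hvlt, hv⟩ := exists_seq_strictMono_tendsto (sSup S)
    have hU : Iio (sSup S) = ⋃ k, Iic (v k) := by
      ext x
      simp only [mem_Iio, mem_iUnion, mem_Iic]
      exact ⟨fun hx => ((hv.eventually (lt_mem_nhds hx)).exists).imp fun _ h => h.le,
        fun ⟨k, hk⟩ => hk.trans_lt (hvlt k)⟩
    rw [hU, Monotone.measure_iUnion (fun i j hij => Iic_subset_Iic.2 (hvm.monotone hij))]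
    refine iSup_le fun k => ?_
    obtain ⟨s, hs, hks⟩ := exists_lt_of_lt_csSup hSne (hvlt k)
    exact (hmono hks.le).trans (le_of_lt hs)
  · obtain ⟨v, hvm, hvlt, hv⟩ := exists_seq_strictAnti_tendsto (sSup S)
    have hI : Iic (sSup S) = ⋂ k, Iic (v k) := by
      ext x
      simp only [mem_iInter, mem_Iic]
      exact ⟨fun hx k => hx.trans (hvlt k).le, fun h => ge_of_tendsto' hv h⟩
    rw [hI, Antitone.measure_iInter (fun i j hij => Iic_subset_Iic.2 (hvm.antitone hij))
      (fun _ => measurableSet_Iic.nullMeasurableSet) ⟨0, measure_ne_top _ _⟩]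
    refine le_iInf fun k => ?_
    by_contra hlt
    exact absurd (le_csSup hSbdd (not_le.1 hlt)) (not_le.2 (hvlt k))

/-- In a one-parameter family of functions in which any two points are separated for almost every
parameter, some member has only null level sets. -/
theorem exists_forall_level_null {α : Type*} [MeasurableSpace α] [MeasurableSingletonClass α]
    (ρ : Measure α) [IsFiniteMeasure ρ] (hρ : ∀ x, ρ {x} = 0) (F : ℝ → α → ℝ)
    (hF : Measurable fun p : ℝ × α => F p.1 p.2) {O : Set α} (hO : ∀ᵐ x ∂ρ, x ∈ O)
    (hsep : ∀ x ∈ O, ∀ y ∈ O, x ≠ y → ∀ᵐ θ ∂(volume : Measure ℝ), F θ x ≠ F θ y) :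
    ∃ θ, ∀ s, ρ {x | F θ x = s} = 0 := by
  have hmeas : MeasurableSet {q : (α × α) × ℝ | F q.2 q.1.1 ≠ F q.2 q.1.2} := by
    refine (measurableSet_eq_fun ?_ ?_).compl
    · exact hF.comp (measurable_snd.prodMk (measurable_fst.comp measurable_fst))
    · exact hF.comp (measurable_snd.prodMk (measurable_snd.comp measurable_fst))
  have hx : ∀ x : α, ∀ᵐ y ∂ρ, x ≠ y := fun x => by
    have : ρ {y | ¬ x ≠ y} = 0 := by
      rw [show {y | ¬ x ≠ y} = {x} by ext y; simp [eq_comm]]; exact hρ x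
    exact this
  have h1 : ∀ᵐ x ∂ρ, ∀ᵐ y ∂ρ, ∀ᵐ θ ∂(volume : Measure ℝ), F θ x ≠ F θ y := by
    filter_upwards [hO] with x hxO
    filter_upwards [hO, hx x] with y hyO hxy using hsep x hxO y hyO hxy
  have h2 : ∀ᵐ p ∂(ρ.prod ρ), ∀ᵐ θ ∂(volume : Measure ℝ), F θ p.1 ≠ F θ p.2 := by
    have hm : MeasurableSet {p : α × α | ∀ᵐ θ ∂(volume : Measure ℝ), F θ p.1 ≠ F θ p.2} := by
      have := measurable_measure_prodMk_left (ν := (volume : Measure ℝ)) hmeas.compl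
      exact this (measurableSet_singleton 0)
    exact (Measure.ae_prod_iff_ae_ae hm).2 h1
  have h3 := (Measure.ae_ae_comm hmeas).1 h2
  obtain ⟨θ, hθ⟩ := h3.exists
  refine ⟨θ, fun s => ?_⟩
  by_contra hs
  have hsub : {x | F θ x = s} ×ˢ {x | F θ x = s} ⊆ {p : α × α | ¬ F θ p.1 ≠ F θ p.2} := by
    rintro ⟨x, y⟩ ⟨h, h'⟩
    exact not_not.2 (Eq.trans h (Eq.symm h'))
  have := measure_mono_null hsub hθ
  rw [Measure.prod_prod] at this
  exact hs (by simpa using this)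

end Quantile

section Bend

/-- The piecewise linear self-map of the line supported in `[A, B]` that sends `c` to `t`. -/
noncomputable def bend (A B c t y : ℝ) : ℝ :=
  y + (t - c) * max 0 (min ((y - A) / (c - A)) ((B - y) / (B - c)))

variable {A B c t y : ℝ}

theorem bend_of_le_left (hc : A < c) (hy : y ≤ A) : bend A B c t y = y := by
  have : (y - A) / (c - A) ≤ 0 := div_nonpos_of_nonpos_of_nonneg (by linarith) (by linarith)
  rw [bend, max_eq_left ((min_le_left _ _).trans this)]
  ring

theorem bend_of_right_le (hc : c < B) (hy : B ≤ y) : bend A B c t y = y := by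
  have : (B - y) / (B - c) ≤ 0 := div_nonpos_of_nonpos_of_nonneg (by linarith) (by linarith)
  rw [bend, max_eq_left ((min_le_right _ _).trans this)]
  ring

theorem bend_of_le (hc : A < c) (hc' : c < B) (hy : A ≤ y) (hyc : y ≤ c) :
    bend A B c t y = A + (y - A) * ((t - A) / (c - A)) := by
  have h1 : 0 < c - A := by linarith
  have h2 : 0 < B - c := by linarith
  have h3 : (y - A) / (c - A) ≤ 1 := (div_le_one h1).2 (by linarith)
  have h4 : 1 ≤ (B - y) / (B - c) := (one_le_div h2).2 (by linarith)
  have h5 : 0 ≤ (y - A) / (c - A) := div_nonneg (by linarith) h1.le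
  rw [bend, min_eq_left (h3.trans h4), max_eq_right h5]
  field_simp
  ring

theorem bend_of_ge (hc : A < c) (hc' : c < B) (hyc : c ≤ y) (hy : y ≤ B) :
    bend A B c t y = B - (B - y) * ((B - t) / (B - c)) := by
  have h1 : 0 < c - A := by linarith
  have h2 : 0 < B - c := by linarith
  have h3 : 1 ≤ (y - A) / (c - A) := (one_le_div h1).2 (by linarith)
  have h4 : (B - y) / (B - c) ≤ 1 := (div_le_one h2).2 (by linarith)
  have h5 : 0 ≤ (B - y) / (B - c) := div_nonneg (by linarith) h2.le
  rw [bend, min_eq_right (h4.trans h3), max_eq_right h5]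
  field_simp
  ring

theorem bend_self : bend A B c c y = y := by simp [bend]

theorem bend_mem_left (hc : A < c) (hc' : c < B) (ht : A < t) (hy : A ≤ y) (hyc : y ≤ c) :
    A ≤ bend A B c t y ∧ bend A B c t y ≤ t := by
  rw [bend_of_le hc hc' hy hyc]
  have h1 : 0 < c - A := by linarith
  have h2 : 0 < (t - A) / (c - A) := div_pos (by linarith) h1
  refine ⟨by nlinarith, ?_⟩
  have : (y - A) * ((t - A) / (c - A)) ≤ (c - A) * ((t - A) / (c - A)) := by gcongr
  rw [mul_div_cancel₀ _ h1.ne'] at this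
  linarith

theorem bend_mem_right (hc : A < c) (hc' : c < B) (ht : t < B) (hyc : c ≤ y) (hy : y ≤ B) :
    t ≤ bend A B c t y ∧ bend A B c t y ≤ B := by
  rw [bend_of_ge hc hc' hyc hy]
  have h1 : 0 < B - c := by linarith
  have h2 : 0 < (B - t) / (B - c) := div_pos (by linarith) h1
  refine ⟨?_, by nlinarith⟩
  have : (B - y) * ((B - t) / (B - c)) ≤ (B - c) * ((B - t) / (B - c)) := by gcongr
  rw [mul_div_cancel₀ _ h1.ne'] at this
  linarith

theorem bend_bend (hc : A < c) (hc' : c < B) (ht : A < t) (ht' : t < B) (y : ℝ) :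
    bend A B t c (bend A B c t y) = y := by
  rcases le_total y A with h | h
  · rw [bend_of_le_left hc h, bend_of_le_left ht h]
  rcases le_total B y with h' | h'
  · rw [bend_of_right_le hc' h', bend_of_right_le ht' h']
  rcases le_total y c with h'' | h''
  · have := bend_mem_left hc hc' ht h h''
    rw [bend_of_le ht ht' this.1 this.2, bend_of_le hc hc' h h'']
    have h1 : c - A ≠ 0 := by linarith
    have h2 : t - A ≠ 0 := by linarith
    field_simp
    ring
  · have := bend_mem_right hc hc' ht' h'' h'
    rw [bend_of_ge ht ht' this.1 this.2, bend_of_ge hc hc' h'' h']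
    have h1 : B - c ≠ 0 := by linarith
    have h2 : B - t ≠ 0 := by linarith
    field_simp
    ring

theorem bend_apply_self (hc : A < c) (hc' : c < B) : bend A B c t c = t := by
  rw [bend_of_le hc hc' hc.le le_rfl, mul_div_cancel₀ _ (by linarith)]
  ring

theorem bend_le_iff (hc : A < c) (hc' : c < B) (ht : A < t) (ht' : t < B) :
    bend A B c t y ≤ t ↔ y ≤ c := by
  constructor
  · intro h
    by_contra hlt
    rw [not_le] at hlt
    rcases le_total B y with h' | h'
    · rw [bend_of_right_le hc' h'] at h
      linarith
    · have h1 := bend_mem_right hc hc' ht' hlt.le h'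
      have h2 : bend A B c t y = t := le_antisymm h h1.1
      have h3 := bend_bend hc hc' ht ht' y
      rw [h2, bend_apply_self ht ht'] at h3
      linarith
  · intro h
    rcases le_total y A with h' | h'
    · rw [bend_of_le_left hc h']
      linarith
    · exact (bend_mem_left hc hc' ht h' h).2

theorem bend_eq_iff (hc : A < c) (hc' : c < B) (ht : A < t) (ht' : t < B) :
    bend A B c t y = t ↔ y = c := by
  constructor
  · intro h
    have h3 := bend_bend hc hc' ht ht' y
    rw [h, bend_apply_self ht ht'] at h3
    exact h3.symm
  · rintro rfl
    exact bend_apply_self hc hc'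

theorem bend_mem_Icc_iff (hc : A < c) (hc' : c < B) (ht : A < t) (ht' : t < B) :
    bend A B c t y ∈ Icc A B ↔ y ∈ Icc A B := by
  rcases lt_or_ge y A with h | h
  · rw [bend_of_le_left hc h.le]
  rcases lt_or_ge B y with h' | h'
  · rw [bend_of_right_le hc' h'.le]
  refine iff_of_true ?_ ⟨h, h'⟩
  rcases le_total y c with h'' | h''
  · have := bend_mem_left hc hc' ht h h''
    exact ⟨this.1, this.2.trans ht'.le⟩
  · have := bend_mem_right hc hc' ht' h'' h'
    exact ⟨ht.le.trans this.1, this.2⟩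

end Bend

section Logistic

/-- An increasing homeomorphism from the line onto `(A, B)` sending `0` to `t`. -/
noncomputable def logistic (A B t v : ℝ) : ℝ :=
  (A + B * ((t - A) / (B - t) * Real.exp v)) / (1 + (t - A) / (B - t) * Real.exp v)

/-- The inverse of `logistic` on `(A, B)`. -/
noncomputable def logisticInv (A B t y : ℝ) : ℝ :=
  Real.log ((y - A) / (B - y) / ((t - A) / (B - t)))

variable {A B t y v : ℝ}

theorem logistic_coeff_pos (ht : A < t) (ht' : t < B) (v : ℝ) :
    0 < (t - A) / (B - t) * Real.exp v :=
  mul_pos (div_pos (by linarith) (by linarith)) (Real.exp_pos _)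

theorem lt_logistic (ht : A < t) (ht' : t < B) : A < logistic A B t v := by
  have h := logistic_coeff_pos ht ht' v
  rw [logistic, lt_div_iff₀ (by linarith)]
  nlinarith

theorem logistic_lt (ht : A < t) (ht' : t < B) : logistic A B t v < B := by
  have h := logistic_coeff_pos ht ht' v
  rw [logistic, div_lt_iff₀ (by linarith)]
  nlinarith

theorem logistic_zero (ht' : t < B) (hAB : A < B) : logistic A B t 0 = t := by
  have h1 : B - t ≠ 0 := by linarith
  have h2 : B - t + (t - A) ≠ 0 := by linarith
  have h3 : 1 + (t - A) / (B - t) ≠ 0 := by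
    rw [show 1 + (t - A) / (B - t) = (B - A) / (B - t) by field_simp; ring]
    exact div_ne_zero (by linarith) h1
  rw [logistic, Real.exp_zero, mul_one, div_eq_iff h3]
  field_simp
  ring

theorem continuous_logistic (ht : A < t) (ht' : t < B) : Continuous (logistic A B t) := by
  unfold logistic
  refine Continuous.div (by fun_prop) (by fun_prop) fun v => ?_
  have h := logistic_coeff_pos ht ht' v
  linarith

theorem le_logistic_iff (ht : A < t) (ht' : t < B) (hy : A < y) (hy' : y < B) :
    y ≤ logistic A B t v ↔ logisticInv A B t y ≤ v := by
  have h := logistic_coeff_pos ht ht' v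
  have h1 : 0 < (t - A) / (B - t) := div_pos (by linarith) (by linarith)
  have h2 : 0 < B - y := by linarith
  have h3 : 0 < (y - A) / (B - y) := div_pos (by linarith) h2
  rw [logisticInv, Real.log_le_iff_le_exp (div_pos h3 h1), div_le_iff₀ h1, div_le_iff₀ h2,
    logistic, le_div_iff₀ (by linarith)]
  constructor <;> intro h <;> nlinarith

theorem logistic_logisticInv (ht : A < t) (ht' : t < B) (hy : A < y) (hy' : y < B) :
    logistic A B t (logisticInv A B t y) = y := by
  have h1 : 0 < (t - A) / (B - t) := div_pos (by linarith) (by linarith)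
  have h2 : 0 < B - y := by linarith
  have h3 : 0 < (y - A) / (B - y) := div_pos (by linarith) h2
  rw [logisticInv, logistic, Real.exp_log (div_pos h3 h1), mul_div_cancel₀ _ h1.ne',
    div_eq_iff (by linarith)]
  field_simp
  ring

theorem logisticInv_logistic (ht : A < t) (ht' : t < B) (v : ℝ) :
    logisticInv A B t (logistic A B t v) = v := by
  have h := logistic_coeff_pos ht ht' v
  have h1 : 0 < (t - A) / (B - t) := div_pos (by linarith) (by linarith)
  have h2 : 0 < B - logistic A B t v := sub_pos.2 (logistic_lt ht ht')
  have h3 : (logistic A B t v - A) / (B - logistic A B t v) =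
      (t - A) / (B - t) * Real.exp v := by
    rw [div_eq_iff h2.ne']
    have : logistic A B t v * (1 + (t - A) / (B - t) * Real.exp v) =
        A + B * ((t - A) / (B - t) * Real.exp v) := div_mul_cancel₀ _ (by linarith)
    linarith
  rw [logisticInv, h3, mul_div_cancel_left₀ _ h1.ne', Real.log_exp]

end Logistic

section Cut

variable {n : ℕ}

/-- The open box with corners `a` and `b`. -/
def openBox (a b : Fin n → ℝ) : Set (Fin n → ℝ) := Set.pi univ fun i => Ioo (a i) (b i)

theorem mem_openBox {a b x : Fin n → ℝ} : x ∈ openBox a b ↔ ∀ i, a i < x i ∧ x i < b i := by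
  simp [openBox]

theorem isOpen_openBox (a b : Fin n → ℝ) : IsOpen (openBox a b) :=
  isOpen_set_pi finite_univ fun _ _ => isOpen_Ioo

theorem openBox_subset_Icc (a b : Fin n → ℝ) : openBox a b ⊆ Icc a b := fun _ hx =>
  ⟨fun i => (mem_openBox.1 hx i).1.le, fun i => (mem_openBox.1 hx i).2.le⟩

/-- Atomless measures of full support that are finite on compact sets. -/
structure IsGoodMeasure {M : Type*} [TopologicalSpace M] [MeasurableSpace M]
    (μ : Measure M) : Prop where
  singleton : ∀ x, μ {x} = 0
  pos : ∀ U : Set M, IsOpen U → U.Nonempty → 0 < μ U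
  compact : ∀ K : Set M, IsCompact K → μ K ≠ ⊤

theorem map_homeomorph_apply {M : Type*} [TopologicalSpace M] [MeasurableSpace M] [BorelSpace M]
    (μ : Measure M) (g : M ≃ₜ M) (s : Set M) : μ.map g s = μ (g ⁻¹' s) :=
  g.toMeasurableEquiv.map_apply s

theorem IsGoodMeasure.map {M : Type*} [TopologicalSpace M] [MeasurableSpace M] [BorelSpace M]
    {μ : Measure M} (h : IsGoodMeasure μ) (g : M ≃ₜ M) : IsGoodMeasure (μ.map g) where
  singleton x := by
    rw [map_homeomorph_apply]
    have : g ⁻¹' {x} = {g.symm x} := by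
      ext y; simp [← g.symm_apply_eq, eq_comm]
    rw [this, h.singleton]
  pos U hU hne := by
    rw [map_homeomorph_apply]
    exact h.pos _ (hU.preimage g.continuous) (hne.preimage g.surjective)
  compact K hK := by
    rw [map_homeomorph_apply]
    exact h.compact _ (g.isCompact_preimage.2 hK)

theorem continuous_bend {X : Type*} [TopologicalSpace X] {A B : ℝ} {c t y : X → ℝ}
    (hc : Continuous c) (ht : Continuous t) (hy : Continuous y) (hA : ∀ x, A < c x)
    (hB : ∀ x, c x < B) : Continuous fun x => bend A B (c x) (t x) (y x) := by
  unfold bend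
  refine hy.add ((ht.sub hc).mul (continuous_const.max (Continuous.min ?_ ?_)))
  · exact (hy.sub continuous_const).div (hc.sub continuous_const) fun x => (sub_pos.2 (hA x)).ne'
  · exact (continuous_const.sub hy).div (continuous_const.sub hc) fun x =>
      ne_of_gt (sub_pos.2 (hB x))

/-- Apply `bend` in the `i`-th coordinate so that the graph of `φ` goes to the level `t`. -/
noncomputable def bendHomeo (i : Fin n) {A B t : ℝ} (φ : (Fin n → ℝ) → ℝ) (hφ : Continuous φ)
    (hφi : ∀ x y, φ (update x i y) = φ x) (hA : ∀ x, A < φ x) (hB : ∀ x, φ x < B)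
    (ht : A < t) (ht' : t < B) : (Fin n → ℝ) ≃ₜ (Fin n → ℝ) where
  toFun x := update x i (bend A B (φ x) t (x i))
  invFun x := update x i (bend A B t (φ x) (x i))
  left_inv x := by simp [hφi, bend_bend (hA x) (hB x) ht ht']
  right_inv x := by simp [hφi, bend_bend ht ht' (hA x) (hB x)]
  continuous_toFun := continuous_id.update i
    (continuous_bend hφ continuous_const (continuous_apply i) hA hB)
  continuous_invFun := continuous_id.update i
    (continuous_bend continuous_const hφ (continuous_apply i) (fun _ => ht) fun _ => ht')

theorem volume_level_null (i : Fin n) (x y : Fin n → ℝ) {j : Fin n} (hj : j ≠ i)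
    (hxy : x j ≠ y j) (p q : ℝ) :
    ∀ᵐ θ ∂(volume : Measure ℝ), p - ∑ j ∈ Finset.univ.erase i, θ ^ ((j : ℕ) + 1) * x j ≠
      q - ∑ j ∈ Finset.univ.erase i, θ ^ ((j : ℕ) + 1) * y j := by
  classical
  set P : Polynomial ℝ := ∑ j ∈ Finset.univ.erase i,
    Polynomial.C (x j - y j) * Polynomial.X ^ ((j : ℕ) + 1) - Polynomial.C (p - q) with hP
  have hP0 : P ≠ 0 := by
    intro h
    have := congrArg (fun Q => Polynomial.coeff Q ((j : ℕ) + 1)) h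
    simp only [hP, Polynomial.coeff_sub, Polynomial.finsetSum_coeff, Polynomial.coeff_C_mul,
      Polynomial.coeff_X_pow, Polynomial.coeff_C, Polynomial.coeff_zero, add_left_inj,
      Fin.val_inj, mul_ite, mul_one, mul_zero, Finset.sum_ite_eq] at this
    simp [hj, sub_eq_zero, hxy] at this
  have hfin : {θ : ℝ | P.IsRoot θ}.Finite := Polynomial.finite_setOfPred_isRoot hP0
  have hnull : ∀ᵐ θ ∂(volume : Measure ℝ), ¬ P.IsRoot θ := by
    have := hfin.measure_zero (volume : Measure ℝ)
    rw [ae_iff]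
    simpa using this
  filter_upwards [hnull] with θ hθ h
  apply hθ
  simp only [Polynomial.IsRoot, hP, Polynomial.eval_sub, Polynomial.eval_finsetSum,
    Polynomial.eval_mul, Polynomial.eval_C, Polynomial.eval_pow, Polynomial.eval_X]
  have : ∑ j ∈ Finset.univ.erase i, (x j - y j) * θ ^ ((j : ℕ) + 1) =
      ∑ j ∈ Finset.univ.erase i, θ ^ ((j : ℕ) + 1) * x j -
        ∑ j ∈ Finset.univ.erase i, θ ^ ((j : ℕ) + 1) * y j := by
    rw [← Finset.sum_sub_distrib]
    exact Finset.sum_congr rfl fun _ _ => by ring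
  rw [this]
  linarith

set_option maxHeartbeats 1600000 in
/-- A good measure on a box admits a graph of a function that cuts off a prescribed mass, is null
and has a prescribed constant boundary value. -/
theorem exists_graph_cut {μ : Measure (Fin n → ℝ)} (hμ : IsGoodMeasure μ)
    {a b : Fin n → ℝ} (hab : ∀ i, a i < b i) (i : Fin n) {t : ℝ} (ht : a i < t) (ht' : t < b i)
    {α : ENNReal} (h0 : 0 < α) (h1 : α < μ (openBox a b)) :
    ∃ φ : (Fin n → ℝ) → ℝ, Continuous φ ∧ (∀ x y, φ (update x i y) = φ x) ∧
      (∀ x, a i < φ x) ∧ (∀ x, φ x < b i) ∧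
      (∀ x, ∀ j ≠ i, ¬ (a j < x j ∧ x j < b j) → φ x = t) ∧
      μ (openBox a b ∩ {x | x i = φ x}) = 0 ∧ μ (openBox a b ∩ {x | x i ≤ φ x}) = α := by
  classical
  set w : (Fin n → ℝ) → ℝ := fun x =>
    ∏ j ∈ Finset.univ.erase i, max 0 (min (x j - a j) (b j - x j)) with hw
  set L : ℝ → (Fin n → ℝ) → ℝ := fun θ x =>
    ∑ j ∈ Finset.univ.erase i, θ ^ ((j : ℕ) + 1) * x j with hL
  set F : ℝ → (Fin n → ℝ) → ℝ := fun θ x =>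
    logisticInv (a i) (b i) t (x i) / w x - L θ x with hF
  have hwc : Continuous w := by fun_prop
  have hLc : Continuous fun p : ℝ × (Fin n → ℝ) => L p.1 p.2 := by fun_prop
  have hwu : ∀ x y, w (update x i y) = w x := fun x y =>
    Finset.prod_congr rfl fun j hj => by rw [update_of_ne (Finset.ne_of_mem_erase hj)]
  have hLu : ∀ θ x y, L θ (update x i y) = L θ x := fun θ x y =>
    Finset.sum_congr rfl fun j hj => by rw [update_of_ne (Finset.ne_of_mem_erase hj)]
  have hwpos : ∀ x ∈ openBox a b, 0 < w x := fun x hx => Finset.prod_pos fun j _ => by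
    have := mem_openBox.1 hx j
    exact lt_max_of_lt_right (lt_min (by linarith) (by linarith))
  have hw0 : ∀ x, ∀ j ≠ i, ¬ (a j < x j ∧ x j < b j) → w x = 0 := fun x j hj hx => by
    refine Finset.prod_eq_zero (Finset.mem_erase.2 ⟨hj, Finset.mem_univ j⟩) (max_eq_left ?_)
    by_contra hlt
    have := lt_min_iff.1 (not_le.1 hlt)
    exact hx ⟨by linarith, by linarith⟩
  have hFm : Measurable fun p : ℝ × (Fin n → ℝ) => F p.1 p.2 := by
    refine Measurable.sub (Measurable.div ?_ (hwc.measurable.comp measurable_snd)) hLc.measurable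
    have : Measurable (logisticInv (a i) (b i) t) := by unfold logisticInv; fun_prop
    exact this.comp ((measurable_pi_apply i).comp measurable_snd)
  set ρ := μ.restrict (openBox a b) with hρ
  have hfin : μ (openBox a b) ≠ ⊤ :=
    ne_top_of_le_ne_top (hμ.compact _ isCompact_Icc) (measure_mono (openBox_subset_Icc a b))
  have : IsFiniteMeasure ρ := ⟨by rw [hρ, Measure.restrict_apply_univ]; exact hfin.lt_top⟩
  have hOm : MeasurableSet (openBox a b) := (isOpen_openBox a b).measurableSet
  obtain ⟨θ, hθ⟩ := exists_forall_level_null ρ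
    (fun x => le_antisymm ((Measure.restrict_apply_le _ _).trans (hμ.singleton x).le) zero_le)
    F hFm (O := openBox a b) (ae_restrict_mem hOm) (by
      intro x hx y hy hxy
      by_cases hj : ∃ j ≠ i, x j ≠ y j
      · obtain ⟨j, hj, hne⟩ := hj
        exact volume_level_null i x y hj hne _ _
      · push Not at hj
        refine Eventually.of_forall fun θ h => hxy ?_
        have hwe : w x = w y := Finset.prod_congr rfl fun j hj' => by
          rw [hj j (Finset.ne_of_mem_erase hj')]
        have hLe : L θ x = L θ y := Finset.sum_congr rfl fun j hj' => by
          rw [hj j (Finset.ne_of_mem_erase hj')]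
        simp only [hF, hLe, hwe, sub_left_inj] at h
        rw [div_left_inj' (hwpos y hy).ne'] at h
        have hxi := mem_openBox.1 hx i
        have hyi := mem_openBox.1 hy i
        have h' := congrArg (logistic (a i) (b i) t) h
        rw [logistic_logisticInv ht ht' hxi.1 hxi.2, logistic_logisticInv ht ht' hyi.1 hyi.2] at h'
        ext j
        by_cases hji : j = i
        · rw [hji, h']
        · exact hj j hji)
  have hFθ : Measurable (F θ) := hFm.comp measurable_prodMk_left
  obtain ⟨s, hs⟩ := exists_measure_Iic_eq (ρ.map (F θ))
    (fun s => by rw [Measure.map_apply hFθ (measurableSet_singleton s)]; exact hθ s) h0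
    (by rw [Measure.map_apply hFθ MeasurableSet.univ, preimage_univ, hρ,
      Measure.restrict_apply_univ]; exact h1)
  rw [Measure.map_apply hFθ measurableSet_Iic] at hs
  set φ : (Fin n → ℝ) → ℝ := fun x => logistic (a i) (b i) t (w x * (s + L θ x)) with hφ
  have hφc : Continuous φ := (continuous_logistic ht ht').comp
    (hwc.mul (continuous_const.add (hLc.comp (continuous_const.prodMk continuous_id))))
  have hφA : ∀ x, a i < φ x := fun x => lt_logistic ht ht'
  have hφB : ∀ x, φ x < b i := fun x => logistic_lt ht ht'
  have hφi : ∀ x y, φ (update x i y) = φ x := fun x y => by simp only [hφ, hwu, hLu]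
  have hφle : ∀ x ∈ openBox a b, (x i ≤ φ x ↔ F θ x ≤ s) := fun x hx => by
    have hxi := mem_openBox.1 hx i
    rw [hφ, le_logistic_iff ht ht' hxi.1 hxi.2, hF, sub_le_iff_le_add, div_le_iff₀ (hwpos x hx),
      mul_comm]
  have hφeq : ∀ x ∈ openBox a b, x i = φ x → F θ x = s := fun x hx h => by
    simp only [hF]
    rw [h, logisticInv_logistic ht ht', mul_div_cancel_left₀ _ (hwpos x hx).ne']
    ring
  refine ⟨φ, hφc, hφi, hφA, hφB, fun x j hj hx => ?_, ?_, ?_⟩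
  · simp only [hφ]
    rw [hw0 x j hj hx, zero_mul, logistic_zero ht' (hab i)]
  · refine measure_mono_null (t := openBox a b ∩ {x | F θ x = s})
      (fun x hx => ⟨hx.1, hφeq x hx.1 hx.2⟩) ?_
    have := hθ s
    rwa [hρ, Measure.restrict_apply' hOm, inter_comm] at this
  · rw [hρ, Measure.restrict_apply' hOm, inter_comm] at hs
    rw [← hs]
    congr 1
    ext x
    exact and_congr_right fun hx => hφle x hx

/-- A good measure can be redistributed inside a box so that a prescribed hyperplane cuts off a
prescribed mass. -/
theorem exists_homeomorph_cut {μ : Measure (Fin n → ℝ)} (hμ : IsGoodMeasure μ)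
    {a b : Fin n → ℝ} (hab : ∀ i, a i < b i) (hbd : μ (Icc a b \ openBox a b) = 0)
    (i : Fin n) {t : ℝ} (ht : a i < t) (ht' : t < b i) {α : ENNReal} (h0 : 0 < α)
    (h1 : α < μ (Icc a b)) :
    ∃ g : (Fin n → ℝ) ≃ₜ (Fin n → ℝ), (∀ x ∉ openBox a b, g x = x) ∧
      μ.map g (Icc a b ∩ {x | x i = t}) = 0 ∧ μ.map g (Icc a (update b i t)) = α := by
  have hIccO : μ (Icc a b) = μ (openBox a b) :=
    le_antisymm ((measure_le_inter_add_sdiff μ _ (openBox a b)).trans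
      (by rw [hbd, add_zero]; exact measure_mono inter_subset_right))
      (measure_mono (openBox_subset_Icc a b))
  obtain ⟨φ, hφc, hφi, hφA, hφB, hφt, hφ0, hφα⟩ :=
    exists_graph_cut hμ hab i ht ht' h0 (hIccO ▸ h1)
  set g := bendHomeo i φ hφc hφi hφA hφB ht ht'
  have hgi : ∀ x, g x i = bend (a i) (b i) (φ x) t (x i) := fun x => update_self _ _ _
  have hgj : ∀ x, ∀ j ≠ i, g x j = x j := fun x j hj => update_of_ne hj _ _
  have hgI : ∀ x, g x ∈ Icc a b ↔ x ∈ Icc a b := fun x => by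
    simp only [← pi_univ_Icc, mem_univ_pi]
    refine forall_congr' fun j => ?_
    by_cases hj : j = i
    · subst hj
      rw [hgi]
      exact bend_mem_Icc_iff (hφA x) (hφB x) ht ht'
    · rw [hgj x j hj]
  refine ⟨g, fun x hx => ?_, ?_, ?_⟩
  · ext j
    by_cases hj : j = i
    · subst hj
      rw [hgi]
      by_cases hk : ∃ k ≠ j, ¬ (a k < x k ∧ x k < b k)
      · obtain ⟨k, hk, hxk⟩ := hk
        rw [hφt x k hk hxk, bend_self]
      · push Not at hk
        rw [mem_openBox, not_forall] at hx
        obtain ⟨k, hxk⟩ := hx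
        have hkj : k = j := by
          by_contra hne
          exact hxk ((hk k hne))
        subst hkj
        rcases le_or_gt (x k) (a k) with h | h
        · exact bend_of_le_left (hφA x) h
        · exact bend_of_right_le (hφB x) (not_lt.1 fun h' => hxk ⟨h, h'⟩)
    · exact hgj x j hj
  · rw [map_homeomorph_apply]
    refine measure_mono_null (t := (openBox a b ∩ {x | x i = φ x}) ∪ (Icc a b \ openBox a b))
      (fun x hx => ?_) (measure_union_null hφ0 hbd)
    have hxI := (hgI x).1 hx.1
    have hxt : g x i = t := hx.2
    rw [hgi, bend_eq_iff (hφA x) (hφB x) ht ht'] at hxt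
    by_cases hxO : x ∈ openBox a b
    · exact Or.inl ⟨hxO, hxt⟩
    · exact Or.inr ⟨hxI, hxO⟩
  · rw [map_homeomorph_apply, ← hφα]
    have hpre : g ⁻¹' Icc a (update b i t) = Icc a b ∩ {x | x i ≤ φ x} := by
      ext x
      have h : g x ∈ Icc a (update b i t) ↔ g x ∈ Icc a b ∧ g x i ≤ t := by
        rw [mem_Icc, mem_Icc, le_update_iff]
        refine ⟨fun h => ⟨⟨h.1, fun j => ?_⟩, h.2.1⟩, fun h => ⟨h.1.1, h.2, fun j _ => h.1.2 j⟩⟩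
        by_cases hj : j = i
        · subst hj
          exact h.2.1.trans ht'.le
        · exact h.2.2 j hj
      rw [mem_preimage, h, hgI, hgi, bend_le_iff (hφA x) (hφB x) ht ht']
      rfl
    rw [hpre]
    refine le_antisymm ?_ (measure_mono (inter_subset_inter_left _ (openBox_subset_Icc a b)))
    refine (measure_mono (t := (openBox a b ∩ {x | x i ≤ φ x}) ∪ (Icc a b \ openBox a b))
      fun x hx => ?_).trans ((measure_union_le _ _).trans (by rw [hbd, add_zero]))
    by_cases hxO : x ∈ openBox a b
    · exact Or.inl ⟨hxO, hx.2⟩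
    · exact Or.inr ⟨hx.1, hxO⟩

end Cut

section BoxMatch

variable {n : ℕ} {a b : Fin n → ℝ} {i : Fin n} {t δ : ℝ} {μ μ' ν : Measure (Fin n → ℝ)}

theorem apply_mem_of_support {E : Type*} [TopologicalSpace E] {g : E ≃ₜ E} {O : Set E}
    (hg : ∀ x ∉ O, g x = x) {x : E} (hx : x ∈ O) : g x ∈ O := by
  by_contra h
  exact h ((g.injective (hg _ h)).symm ▸ hx)

theorem mem_Icc_update_right (ht : t ≤ b i) {x : Fin n → ℝ} :
    x ∈ Icc a (update b i t) ↔ x ∈ Icc a b ∧ x i ≤ t := by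
  rw [mem_Icc, mem_Icc, le_update_iff]
  refine ⟨fun h => ⟨⟨h.1, fun j => ?_⟩, h.2.1⟩, fun h => ⟨h.1.1, h.2, fun j _ => h.1.2 j⟩⟩
  by_cases hj : j = i
  · subst hj
    exact h.2.1.trans ht
  · exact h.2.2 j hj

theorem mem_Icc_update_left (ht : a i ≤ t) {x : Fin n → ℝ} :
    x ∈ Icc (update a i t) b ↔ x ∈ Icc a b ∧ t ≤ x i := by
  rw [mem_Icc, mem_Icc, update_le_iff]
  refine ⟨fun h => ⟨⟨fun j => ?_, h.2⟩, h.1.1⟩, fun h => ⟨⟨h.2, fun j _ => h.1.1 j⟩, h.1.2⟩⟩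
  by_cases hj : j = i
  · subst hj
    exact ht.trans h.1.1
  · exact h.1.2 j hj

theorem mem_openBox_update_right (ht : t ≤ b i) {x : Fin n → ℝ} :
    x ∈ openBox a (update b i t) ↔ x ∈ openBox a b ∧ x i < t := by
  simp only [mem_openBox]
  refine ⟨fun h => ⟨fun j => ⟨(h j).1, ?_⟩, by simpa using (h i).2⟩, fun h j => ⟨(h.1 j).1, ?_⟩⟩ <;>
    by_cases hj : j = i
  · subst hj
    exact lt_of_lt_of_le (by simpa using (h j).2) ht
  · simpa [hj] using (h j).2
  · subst hj
    simpa using h.2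
  · simpa [hj] using (h.1 j).2

theorem mem_openBox_update_left (ht : a i ≤ t) {x : Fin n → ℝ} :
    x ∈ openBox (update a i t) b ↔ x ∈ openBox a b ∧ t < x i := by
  simp only [mem_openBox]
  refine ⟨fun h => ⟨fun j => ⟨?_, (h j).2⟩, by simpa using (h i).1⟩, fun h j => ⟨?_, (h.1 j).2⟩⟩ <;>
    by_cases hj : j = i
  · subst hj
    exact lt_of_le_of_lt ht (by simpa using (h j).1)
  · simpa [hj] using (h j).1
  · subst hj
    simpa using h.2
  · simpa [hj] using (h.1 j).1

theorem boundary_update_right (ht : t ≤ b i) :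
    Icc a (update b i t) \ openBox a (update b i t) ⊆
      (Icc a b \ openBox a b) ∪ (Icc a b ∩ {x | x i = t}) := by
  rintro x ⟨hx, hx'⟩
  rw [mem_Icc_update_right ht] at hx
  rw [mem_openBox_update_right ht, not_and, not_lt] at hx'
  by_cases h : x ∈ openBox a b
  · exact Or.inr ⟨hx.1, le_antisymm hx.2 (hx' h)⟩
  · exact Or.inl ⟨hx.1, h⟩

theorem boundary_update_left (ht : a i ≤ t) :
    Icc (update a i t) b \ openBox (update a i t) b ⊆
      (Icc a b \ openBox a b) ∪ (Icc a b ∩ {x | x i = t}) := by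
  rintro x ⟨hx, hx'⟩
  rw [mem_Icc_update_left ht] at hx
  rw [mem_openBox_update_left ht, not_and, not_lt] at hx'
  by_cases h : x ∈ openBox a b
  · exact Or.inr ⟨hx.1, le_antisymm (hx' h) hx.2⟩
  · exact Or.inl ⟨hx.1, h⟩

/-- Cutting a box along a null hyperplane section is additive on outer measures. -/
theorem measure_inter_cut (ν : Measure (Fin n → ℝ)) (ht : a i ≤ t) (ht' : t ≤ b i)
    (hν : ν (Icc a b ∩ {x | x i = t}) = 0) (S : Set (Fin n → ℝ)) :
    ν (S ∩ Icc a b) = ν (S ∩ Icc a (update b i t)) + ν (S ∩ Icc (update a i t) b) := by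
  rw [← measure_inter_add_sdiff (S ∩ Icc a b) (measurableSet_Icc (a := a) (b := update b i t))]
  congr 1
  · congr 1
    ext x
    simp only [mem_inter_iff, mem_Icc_update_right ht']
    tauto
  · refine le_antisymm (measure_mono ?_) ?_
    · rintro x ⟨⟨hxS, hx⟩, hx'⟩
      rw [mem_Icc_update_right ht', not_and, not_le] at hx'
      exact ⟨hxS, (mem_Icc_update_left ht).2 ⟨hx, (hx' hx).le⟩⟩
    · refine (measure_mono (t := ((S ∩ Icc a b) \ Icc a (update b i t)) ∪
        (Icc a b ∩ {x | x i = t})) ?_).trans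
        ((measure_union_le _ _).trans (by rw [hν, add_zero]))
      rintro x ⟨hxS, hx⟩
      rw [mem_Icc_update_left ht] at hx
      rcases hx.2.eq_or_lt with h | h
      · exact Or.inr ⟨hx.1, h.symm⟩
      · exact Or.inl ⟨⟨hxS, hx.1⟩, fun h' => ((mem_Icc_update_right ht').1 h').2.not_gt h⟩

theorem measure_Icc_cut (ν : Measure (Fin n → ℝ)) (ht : a i ≤ t) (ht' : t ≤ b i)
    (hν : ν (Icc a b ∩ {x | x i = t}) = 0) :
    ν (Icc a b) = ν (Icc a (update b i t)) + ν (Icc (update a i t) b) := by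
  simpa using measure_inter_cut ν ht ht' hν univ

/-- `μ` and `ν` give the same mass to every cell of some subdivision of the box `[a, b]` into
boxes of mesh at most `δ` with null boundaries, obtained by successive hyperplane cuts. -/
inductive BoxMatch (δ : ℝ) (μ ν : Measure (Fin n → ℝ)) :
    (Fin n → ℝ) → (Fin n → ℝ) → Prop
  | leaf {a b : Fin n → ℝ} (hab : ∀ i, a i < b i) (hδ : ∀ i, b i - a i ≤ δ) (h : μ (Icc a b) = ν (Icc a b))
      (hμ : μ (Icc a b \ openBox a b) = 0) (hν : ν (Icc a b \ openBox a b) = 0) : BoxMatch δ μ ν a b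
  | node {a b : Fin n → ℝ} (i : Fin n) (t : ℝ) (hat : a i < t) (htb : t < b i)
      (hμ : μ (Icc a b ∩ {x | x i = t}) = 0) (hν : ν (Icc a b ∩ {x | x i = t}) = 0)
      (hl : BoxMatch δ μ ν a (update b i t)) (hr : BoxMatch δ μ ν (update a i t) b) :
      BoxMatch δ μ ν a b

theorem BoxMatch.symm (h : BoxMatch δ μ ν a b) : BoxMatch δ ν μ a b := by
  induction h with
  | leaf hab hδ h hμ hν => exact .leaf hab hδ h.symm hν hμ
  | node i t hat htb hμ hν _ _ ihl ihr => exact .node i t hat htb hν hμ ihl ihr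

theorem BoxMatch.congr (h : BoxMatch δ μ ν a b) (hμ' : ∀ S ⊆ Icc a b, μ' S = μ S) :
    BoxMatch δ μ' ν a b := by
  induction h with
  | leaf hab hδ h hμ hν =>
    exact .leaf hab hδ ((hμ' _ subset_rfl).trans h) ((hμ' _ sdiff_subset).trans hμ) hν
  | node i t hat htb hμ hν _ _ ihl ihr =>
    exact .node i t hat htb ((hμ' _ inter_subset_left).trans hμ) hν
      (ihl fun S hS => hμ' S fun x hx => ((mem_Icc_update_right htb.le).1 (hS hx)).1)
      (ihr fun S hS => hμ' S fun x hx => ((mem_Icc_update_left hat.le).1 (hS hx)).1)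

/-- Redistributions of the two halves of a box combine. -/
theorem BoxMatch.glue (hat : a i < t) (htb : t < b i) {g₁ g₂ : (Fin n → ℝ) ≃ₜ (Fin n → ℝ)}
    (hg₁ : ∀ x ∉ openBox a (update b i t), g₁ x = x)
    (hg₂ : ∀ x ∉ openBox (update a i t) b, g₂ x = x)
    (hμ : μ (Icc a b ∩ {x | x i = t}) = 0) (hν : ν (Icc a b ∩ {x | x i = t}) = 0)
    (hl : BoxMatch δ (μ.map g₁) ν a (update b i t))
    (hr : BoxMatch δ (μ.map g₂) ν (update a i t) b) :
    (∀ x ∉ openBox a b, (g₂.trans g₁) x = x) ∧ BoxMatch δ (μ.map (g₂.trans g₁)) ν a b := by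
  have hm₁ : ∀ x, x ∈ openBox a (update b i t) → g₁ x i < t := fun x hx =>
    ((mem_openBox_update_right htb.le).1 (apply_mem_of_support hg₁ hx)).2
  have hm₂ : ∀ x, x ∈ openBox (update a i t) b → t < g₂ x i := fun x hx =>
    ((mem_openBox_update_left hat.le).1 (apply_mem_of_support hg₂ hx)).2
  have hpl : ∀ S ⊆ Icc a (update b i t), (g₂.trans g₁) ⁻¹' S = g₁ ⁻¹' S := by
    intro S hS
    ext x
    simp only [mem_preimage, Homeomorph.trans_apply]
    by_cases hx : x ∈ openBox (update a i t) b
    · have h1 := hm₂ x hx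
      have h2 := ((mem_openBox_update_left hat.le).1 hx).2
      rw [hg₁ (g₂ x) fun h => ((mem_openBox_update_right htb.le).1 h).2.not_gt h1,
        hg₁ x fun h => ((mem_openBox_update_right htb.le).1 h).2.not_gt h2]
      exact iff_of_false (fun h => ((mem_Icc_update_right htb.le).1 (hS h)).2.not_gt h1)
        fun h => ((mem_Icc_update_right htb.le).1 (hS h)).2.not_gt h2
    · rw [hg₂ x hx]
  have hpr : ∀ S ⊆ Icc (update a i t) b, (g₂.trans g₁) ⁻¹' S = g₂ ⁻¹' S := by
    intro S hS
    ext x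
    simp only [mem_preimage, Homeomorph.trans_apply]
    by_cases hx : g₂ x ∈ openBox a (update b i t)
    · have h1 := hm₁ _ hx
      have h2 := ((mem_openBox_update_right htb.le).1 hx).2
      exact iff_of_false (fun h => ((mem_Icc_update_left hat.le).1 (hS h)).2.not_gt h1)
        fun h => ((mem_Icc_update_left hat.le).1 (hS h)).2.not_gt h2
    · rw [hg₁ _ hx]
  refine ⟨fun x hx => ?_, .node i t hat htb ?_ hν (hl.congr fun S hS => ?_)
    (hr.congr fun S hS => ?_)⟩
  · have h2 : g₂ x = x := hg₂ x fun h => hx ((mem_openBox_update_left hat.le).1 h).1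
    have h1 : g₁ x = x := hg₁ x fun h => hx ((mem_openBox_update_right htb.le).1 h).1
    rw [Homeomorph.trans_apply, h2, h1]
  · rw [map_homeomorph_apply, hpl _ fun x hx =>
      (mem_Icc_update_right htb.le).2 ⟨hx.1, (show x i = t from hx.2).le⟩]
    refine measure_mono_null (fun x hx => ?_) hμ
    by_cases h : x ∈ openBox a (update b i t)
    · exact absurd hx.2 (hm₁ x h).ne
    · rwa [mem_preimage, hg₁ x h] at hx
  · rw [map_homeomorph_apply, map_homeomorph_apply, hpl S hS]
  · rw [map_homeomorph_apply, map_homeomorph_apply, hpr S hS]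

theorem openBox_nonempty (hab : ∀ i, a i < b i) : (openBox a b).Nonempty :=
  ⟨fun i => (a i + b i) / 2, mem_openBox.2 fun i => by
    have := hab i
    constructor <;> linarith⟩

theorem IsGoodMeasure.Icc_pos (hμ : IsGoodMeasure μ) (hab : ∀ i, a i < b i) : 0 < μ (Icc a b) :=
  (hμ.pos _ (isOpen_openBox a b) (openBox_nonempty hab)).trans_le
    (measure_mono (openBox_subset_Icc a b))

theorem IsGoodMeasure.exists_level_null (hμ : IsGoodMeasure μ) (a b : Fin n → ℝ) (i : Fin n)
    {s u : ℝ} (hsu : s < u) : ∃ t, s < t ∧ t < u ∧ μ (Icc a b ∩ {x | x i = t}) = 0 := by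
  have : IsFiniteMeasure (μ.restrict (Icc a b)) :=
    ⟨by rw [Measure.restrict_apply_univ]; exact (hμ.compact _ isCompact_Icc).lt_top⟩
  have hc := Measure.countable_meas_level_set_pos (μ := μ.restrict (Icc a b))
    (measurable_pi_apply (X := fun _ : Fin n => ℝ) i)
  obtain ⟨t, ht, ht'⟩ := (hc.dense_compl ℝ).exists_between hsu
  refine ⟨t, ht'.1, ht'.2, ?_⟩
  have h0 : (μ.restrict (Icc a b)) {x | x i = t} = 0 := by
    by_contra h
    exact ht (pos_iff_ne_zero.2 h)
  rwa [Measure.restrict_apply' measurableSet_Icc, inter_comm] at h0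

theorem update_right_lt (hab : ∀ i, a i < b i) (hat : a i < t) (j : Fin n) :
    a j < update b i t j := by
  by_cases hj : j = i
  · subst hj
    simpa using hat
  · simpa [hj] using hab j

theorem update_left_lt (hab : ∀ i, a i < b i) (htb : t < b i) (j : Fin n) :
    update a i t j < b j := by
  by_cases hj : j = i
  · subst hj
    simpa using htb
  · simpa [hj] using hab j

/-- Two good measures of equal mass on a box can be matched at every scale. -/
theorem exists_boxMatch {ν : Measure (Fin n → ℝ)} (hν : IsGoodMeasure ν) {η : ℝ} (hη : 0 < η)
    (N : ℕ) : ∀ {μ : Measure (Fin n → ℝ)} (_ : IsGoodMeasure μ) {a b : Fin n → ℝ}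
      (_ : ∀ i, a i < b i) (_ : μ (Icc a b) = ν (Icc a b)) (_ : μ (Icc a b \ openBox a b) = 0)
      (_ : ν (Icc a b \ openBox a b) = 0) (_ : ∑ i, (b i - a i) ≤ N * η),
      ∃ g : (Fin n → ℝ) ≃ₜ (Fin n → ℝ), (∀ x ∉ openBox a b, g x = x) ∧
        BoxMatch (3 * η) (μ.map g) ν a b := by
  induction N with
  | zero =>
    intro μ hμ a b hab h hμ0 hν0 hN
    refine ⟨Homeomorph.refl _, fun _ _ => rfl, .leaf hab (fun i => ?_) ?_ ?_ hν0⟩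
    · have h1 : b i - a i ≤ ∑ i, (b i - a i) :=
        Finset.single_le_sum (f := fun i => b i - a i) (fun j _ => (sub_pos.2 (hab j)).le)
          (Finset.mem_univ i)
      have : (0 : ℝ) < 3 * η := by linarith
      simp only [Nat.cast_zero, zero_mul] at hN
      linarith
    · rw [map_homeomorph_apply]; exact h
    · rw [map_homeomorph_apply]; exact hμ0
  | succ N ih =>
    intro μ hμ a b hab h hμ0 hν0 hN
    by_cases hsmall : ∀ i, b i - a i ≤ 3 * η
    · refine ⟨Homeomorph.refl _, fun _ _ => rfl, .leaf hab hsmall ?_ ?_ hν0⟩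
      · rw [map_homeomorph_apply]; exact h
      · rw [map_homeomorph_apply]; exact hμ0
    push Not at hsmall
    obtain ⟨i, hi⟩ := hsmall
    obtain ⟨t, hat, htb, hνt⟩ :=
      hν.exists_level_null a b i (show a i + η < b i - η by linarith)
    have hat' : a i < t := by linarith
    have htb' : t < b i := by linarith
    have hcut := measure_Icc_cut ν hat'.le htb'.le hνt
    have hlpos := hν.Icc_pos (update_right_lt hab hat')
    have hrpos := hν.Icc_pos (update_left_lt hab htb')
    have hlfin := hν.compact _ (isCompact_Icc (a := a) (b := update b i t))
    obtain ⟨g, hg, hgt, hgl⟩ := exists_homeomorph_cut hμ hab hμ0 i hat' htb' hlpos (by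
      rw [h, hcut]
      exact ENNReal.lt_add_right hlfin hrpos.ne')
    have hμg := hμ.map g
    have hpre : ∀ S, (∀ x, x ∈ openBox a b → x ∉ S) → g ⁻¹' S ⊆ S := fun S hS x hx => by
      by_cases hxO : x ∈ openBox a b
      · exact absurd hx (hS _ (apply_mem_of_support hg hxO))
      · rwa [mem_preimage, hg x hxO] at hx
    have hg0 : μ.map g (Icc a b \ openBox a b) = 0 := by
      rw [map_homeomorph_apply]
      exact measure_mono_null (hpre _ fun x hx hx' => hx'.2 hx) hμ0
    have hgI : μ.map g (Icc a b) = ν (Icc a b) := by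
      rw [map_homeomorph_apply, ← h]
      congr 1
      ext x
      by_cases hxO : x ∈ openBox a b
      · exact iff_of_true (openBox_subset_Icc a b (apply_mem_of_support hg hxO))
          (openBox_subset_Icc a b hxO)
      · rw [mem_preimage, hg x hxO]
    have hgr : μ.map g (Icc (update a i t) b) = ν (Icc (update a i t) b) := by
      have h1 := measure_Icc_cut (μ.map g) hat'.le htb'.le hgt
      rw [hgI, hcut, hgl] at h1
      exact ((ENNReal.add_right_inj hlfin).1 h1).symm
    have hsuml : ∑ j, (update b i t j - a j) ≤ N * η := by
      have : ∑ j, (update b i t j - a j) = ∑ j, (b j - a j) - (b i - t) := by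
        rw [eq_sub_iff_add_eq, ← Finset.add_sum_erase _ _ (Finset.mem_univ i),
          ← Finset.add_sum_erase Finset.univ (fun j => b j - a j) (Finset.mem_univ i),
          Finset.sum_congr rfl fun j hj => by rw [update_of_ne (Finset.ne_of_mem_erase hj)],
          update_self]
        ring
      rw [this]
      push_cast at hN
      linarith
    have hsumr : ∑ j, (b j - update a i t j) ≤ N * η := by
      have : ∑ j, (b j - update a i t j) = ∑ j, (b j - a j) - (t - a i) := by
        rw [eq_sub_iff_add_eq, ← Finset.add_sum_erase _ _ (Finset.mem_univ i),
          ← Finset.add_sum_erase Finset.univ (fun j => b j - a j) (Finset.mem_univ i),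
          Finset.sum_congr rfl fun j hj => by rw [update_of_ne (Finset.ne_of_mem_erase hj)],
          update_self]
        ring
      rw [this]
      push_cast at hN
      linarith
    obtain ⟨g₁, hg₁, hm₁⟩ := ih hμg (update_right_lt hab hat') hgl
      (measure_mono_null (boundary_update_right htb'.le) (measure_union_null hg0 hgt))
      (measure_mono_null (boundary_update_right htb'.le) (measure_union_null hν0 hνt)) hsuml
    obtain ⟨g₂, hg₂, hm₂⟩ := ih hμg (update_left_lt hab htb') hgr
      (measure_mono_null (boundary_update_left hat'.le) (measure_union_null hg0 hgt))
      (measure_mono_null (boundary_update_left hat'.le) (measure_union_null hν0 hνt)) hsumr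
    obtain ⟨hs, hm⟩ := BoxMatch.glue hat' htb' hg₁ hg₂ hgt hνt hm₁ hm₂
    refine ⟨g.trans (g₂.trans g₁), fun x hx => ?_, ?_⟩
    · rw [Homeomorph.trans_apply, hg x hx, hs x hx]
    · rw [Measure.map_map (g₂.trans g₁).continuous.measurable g.continuous.measurable] at hm
      exact hm

/-- A matching at scale `δ` can be improved to any finer scale by moving points at most `δ`. -/
theorem BoxMatch.refine (h : BoxMatch δ μ ν a b) (hμ : IsGoodMeasure μ) (hν : IsGoodMeasure ν)
    {δ' : ℝ} (hδ' : 0 < δ') :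
    ∃ g : (Fin n → ℝ) ≃ₜ (Fin n → ℝ), (∀ x ∉ openBox a b, g x = x) ∧
      (∀ x, g x = x ∨ ∀ i, |g x i - x i| ≤ δ) ∧ BoxMatch δ' (μ.map g) ν a b := by
  induction h with
  | @leaf a b hab hδ h hμ0 hν0 =>
    obtain ⟨N, hN⟩ := exists_nat_ge ((∑ i, (b i - a i)) / (δ' / 3))
    rw [div_le_iff₀ (by positivity)] at hN
    obtain ⟨g, hg, hm⟩ := exists_boxMatch hν (show 0 < δ' / 3 by positivity) N hμ hab h hμ0 hν0 hN
    rw [mul_div_cancel₀ _ (by norm_num)] at hm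
    refine ⟨g, hg, fun x => ?_, hm⟩
    by_cases hx : x ∈ openBox a b
    · right
      intro i
      have h1 := mem_openBox.1 hx i
      have h2 := mem_openBox.1 (apply_mem_of_support hg hx) i
      have := hδ i
      rw [abs_le]
      constructor <;> linarith
    · exact Or.inl (hg x hx)
  | @node a b i t hat htb hμt hνt _ _ ihl ihr =>
    obtain ⟨g₁, hg₁, hd₁, hm₁⟩ := ihl
    obtain ⟨g₂, hg₂, hd₂, hm₂⟩ := ihr
    obtain ⟨hs, hm⟩ := BoxMatch.glue hat htb hg₁ hg₂ hμt hνt hm₁ hm₂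
    refine ⟨g₂.trans g₁, hs, fun x => ?_, hm⟩
    rw [Homeomorph.trans_apply]
    by_cases hx : x ∈ openBox (update a i t) b
    · have h1 := ((mem_openBox_update_left hat.le).1 (apply_mem_of_support hg₂ hx)).2
      rw [hg₁ (g₂ x) fun h => ((mem_openBox_update_right htb.le).1 h).2.not_gt h1]
      exact hd₂ x
    · rw [hg₂ x hx]
      exact hd₁ x

theorem BoxMatch.measure_le (h : BoxMatch δ μ ν a b) (S : Set (Fin n → ℝ)) :
    μ (S ∩ Icc a b) ≤ ν ({x | ∃ y ∈ S, ∀ i, |x i - y i| ≤ δ} ∩ Icc a b) := by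
  induction h with
  | @leaf a b hab hδ h hμ0 hν0 =>
    rcases (S ∩ Icc a b).eq_empty_or_nonempty with he | ⟨y, hyS, hy⟩
    · simp [he]
    · refine (measure_mono inter_subset_right).trans (h.le.trans (measure_mono fun x hx => ?_))
      refine ⟨⟨y, hyS, fun i => ?_⟩, hx⟩
      have := hδ i
      rw [abs_le]
      constructor <;> linarith [hx.1 i, hx.2 i, hy.1 i, hy.2 i]
  | node i t hat htb hμt hνt _ _ ihl ihr =>
    rw [measure_inter_cut _ hat.le htb.le hμt, measure_inter_cut _ hat.le htb.le hνt]
    gcongr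

end BoxMatch

section OxtobyUlam

/-- A geometrically two-sided Cauchy sequence of homeomorphisms converges to a homeomorphism. -/
theorem exists_homeomorph_limit {E : Type*} [MetricSpace E] [CompleteSpace E] (H : ℕ → E ≃ₜ E)
    (D : ℝ) (h₁ : ∀ k x, dist (H k x) (H (k + 1) x) ≤ D / 2 / 2 ^ k)
    (h₂ : ∀ k x, dist ((H k).symm x) ((H (k + 1)).symm x) ≤ D / 2 / 2 ^ k) :
    ∃ h : E ≃ₜ E, ∀ k x, dist (H k x) (h x) ≤ D / 2 ^ k := by
  have key : ∀ G : ℕ → E → E, (∀ k, Continuous (G k)) →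
      (∀ k x, dist (G k x) (G (k + 1) x) ≤ D / 2 / 2 ^ k) →
      ∃ g : E → E, Continuous g ∧ (∀ k x, dist (G k x) (g x) ≤ D / 2 ^ k) ∧
        TendstoUniformly G g atTop := by
    intro G hGc hG
    have hlim : ∀ x, ∃ y, Tendsto (fun k => G k x) atTop (𝓝 y) := fun x =>
      cauchySeq_tendsto_of_complete (cauchySeq_of_le_geometric_two fun k => hG k x)
    choose g hg using hlim
    have hd : ∀ k x, dist (G k x) (g x) ≤ D / 2 ^ k := fun k x =>
      dist_le_of_le_geometric_two_of_tendsto (fun k => hG k x) (hg x) k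
    have h0 : Tendsto (fun k : ℕ => D / 2 ^ k) atTop (𝓝 0) := by
      have := (tendsto_pow_atTop_nhds_zero_of_lt_one (r := (1 / 2 : ℝ)) (by norm_num)
        (by norm_num)).const_mul D
      simpa [div_eq_mul_inv] using this
    have hu : TendstoUniformly G g atTop := by
      rw [Metric.tendstoUniformly_iff]
      intro ε hε
      filter_upwards [h0.eventually (gt_mem_nhds hε)] with k hk x
      rw [dist_comm]
      exact (hd k x).trans_lt hk
    exact ⟨g, hu.continuous (Frequently.of_forall hGc), hd, hu⟩
  obtain ⟨f, hf, hfd, hfu⟩ := key (fun k => H k) (fun k => (H k).continuous) h₁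
  obtain ⟨g, hg, -, hgu⟩ := key (fun k => (H k).symm) (fun k => (H k).symm.continuous) h₂
  refine ⟨⟨⟨f, g, fun x => ?_, fun x => ?_⟩, hf, hg⟩, hfd⟩
  · have h := hgu.tendsto_comp hg.continuousAt (hfu.tendsto_at x)
    simp only [Homeomorph.symm_apply_apply] at h
    exact tendsto_nhds_unique h tendsto_const_nhds
  · have h := hfu.tendsto_comp hf.continuousAt (hgu.tendsto_at x)
    simp only [Homeomorph.apply_symm_apply] at h
    exact tendsto_nhds_unique h tendsto_const_nhds

variable {n : ℕ} {a b : Fin n → ℝ} {δ ε ε' : ℝ} {μ ν : Measure (Fin n → ℝ)}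
  {A B : (Fin n → ℝ) ≃ₜ (Fin n → ℝ)}

theorem symm_eq_self_of_support {O : Set (Fin n → ℝ)} (hA : ∀ x ∉ O, A x = x) :
    ∀ x ∉ O, A.symm x = x := fun x hx => A.symm_apply_eq.2 (hA x hx).symm

theorem uniformContinuous_of_support (hA : ∀ x ∉ openBox a b, A x = x) :
    UniformContinuous A := by
  have hc : HasCompactSupport fun x => A x - x :=
    HasCompactSupport.intro (isCompact_Icc (a := a) (b := b)) fun x hx => by
      rw [hA x fun h => hx (openBox_subset_Icc a b h), sub_self]
  have h := (hc.uniformContinuous_of_continuous (A.continuous.sub continuous_id)).add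
    uniformContinuous_id
  simpa using h

/-- A stage of the back-and-forth construction: the two measures are transported so as to match
at a scale `δ` at which the inverses of the transporting homeomorphisms are under control. -/
structure MatchState (μ ν : Measure (Fin n → ℝ)) (a b : Fin n → ℝ)
    (A B : (Fin n → ℝ) ≃ₜ (Fin n → ℝ)) (δ ε ε' : ℝ) : Prop where
  pos : 0 < δ
  suppA : ∀ x ∉ openBox a b, A x = x
  suppB : ∀ x ∉ openBox a b, B x = x
  boxMatch : BoxMatch δ (μ.map A) (ν.map B) a b
  modA : ∀ u v, dist u v ≤ δ → dist (A.symm u) (A.symm v) ≤ ε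
  modB : ∀ u v, dist u v ≤ 3 * δ → dist (B.symm u) (B.symm v) ≤ ε'

theorem MatchState.step (h : MatchState μ ν a b A B δ ε ε') (hμ : IsGoodMeasure μ)
    (hν : IsGoodMeasure ν) {ε'' : ℝ} (hε : 0 < ε'') :
    ∃ (B' : (Fin n → ℝ) ≃ₜ (Fin n → ℝ)) (δ' : ℝ), MatchState ν μ a b B' A δ' ε' ε'' ∧
      (∀ x, dist (B.symm (A x)) (B'.symm (A x)) ≤ ε') ∧
      ∀ x, dist (A.symm (B x)) (A.symm (B' x)) ≤ ε := by
  obtain ⟨r, hr, hr'⟩ := Metric.uniformContinuous_iff.1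
    (uniformContinuous_of_support (symm_eq_self_of_support h.suppA)) ε'' hε
  have hpos := h.pos
  set δ' := min δ (r / 4)
  have hδ' : 0 < δ' := lt_min hpos (by positivity)
  have hδ'δ : δ' ≤ δ := min_le_left _ _
  have hδ'r : δ' ≤ r / 4 := min_le_right _ _
  obtain ⟨g, hg, hgd, hm⟩ := h.boxMatch.symm.refine (hν.map B) (hμ.map A) hδ'
  have hd : ∀ x, dist (g x) x ≤ δ := fun x => by
    rcases hgd x with h' | h'
    · rw [h', dist_self]
      exact hpos.le
    · exact (dist_pi_le_iff hpos.le).2 h'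
  have hds : ∀ x, dist x (g.symm x) ≤ δ := fun x => by
    simpa using hd (g.symm x)
  refine ⟨B.trans g, δ', ⟨hδ', fun x hx => ?_, h.suppA, ?_, fun u v huv => ?_, fun u v huv => ?_⟩,
    fun x => ?_, fun x => ?_⟩
  · rw [Homeomorph.trans_apply, h.suppB x hx, hg x hx]
  · rw [Measure.map_map g.continuous.measurable B.continuous.measurable] at hm
    exact hm
  · refine h.modB (g.symm u) (g.symm v) ?_
    have h1 := hds u
    have h2 := hds v
    rw [dist_comm] at h1
    have h3 := dist_triangle4 (g.symm u) u v (g.symm v)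
    linarith
  · exact (hr' (by linarith)).le
  · exact h.modB _ _ ((hds _).trans (by linarith))
  · exact h.modA _ _ (by rw [dist_comm]; exact hd _)

theorem MatchState.measure_le (h : MatchState μ ν a b A B δ ε ε') (S : Set (Fin n → ℝ)) :
    μ ({x | B.symm (A x) ∈ S} ∩ Icc a b) ≤ ν ({x | ∃ y ∈ S, dist x y ≤ ε'} ∩ Icc a b) := by
  have key : ∀ G : (Fin n → ℝ) ≃ₜ (Fin n → ℝ), (∀ x ∉ openBox a b, G x = x) →
      ∀ x, G x ∈ Icc a b ↔ x ∈ Icc a b := fun G hG x => by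
    by_cases hx : x ∈ openBox a b
    · exact iff_of_true (openBox_subset_Icc a b (apply_mem_of_support hG hx))
        (openBox_subset_Icc a b hx)
    · rw [hG x hx]
  have h1 := h.boxMatch.measure_le (B.symm ⁻¹' S)
  rw [map_homeomorph_apply, map_homeomorph_apply] at h1
  refine (measure_mono ?_).trans (h1.trans (measure_mono ?_))
  · rintro x ⟨hx, hxI⟩
    exact ⟨hx, (key A h.suppA x).2 hxI⟩
  · rintro x ⟨⟨y, hy, hxy⟩, hxI⟩
    refine ⟨⟨B.symm y, hy, ?_⟩, (key B h.suppB x).1 hxI⟩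
    have := h.modB (B x) y (((dist_pi_le_iff h.pos.le).2 hxy).trans (by linarith [h.pos]))
    rwa [B.symm_apply_apply] at this

theorem MatchState.exists_homeomorph {C : ℝ} (hC : 0 < C) {δ : ℝ}
    (h : MatchState μ ν a b (.refl _) (.refl _) δ C C) (hμ : IsGoodMeasure μ)
    (hν : IsGoodMeasure ν) :
    ∃ g : (Fin n → ℝ) ≃ₜ (Fin n → ℝ), (∀ x ∉ openBox a b, g x = x) ∧
      ∃ D, ∀ k : ℕ, ∃ (A B : (Fin n → ℝ) ≃ₜ (Fin n → ℝ)) (δ : ℝ),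
        MatchState μ ν a b A B δ (C / 2 ^ k) (C / 2 ^ k) ∧
          ∀ x, dist (B.symm (A x)) (g x) ≤ D / 2 ^ k := by
  let S : ℕ → Type := fun k =>
    {p : ((Fin n → ℝ) ≃ₜ (Fin n → ℝ)) × ((Fin n → ℝ) ≃ₜ (Fin n → ℝ)) × ℝ //
      MatchState μ ν a b p.1 p.2.1 p.2.2 (C / 2 ^ k) (C / 2 ^ k)}
  let H : ∀ k, S k → ((Fin n → ℝ) ≃ₜ (Fin n → ℝ)) := fun _ p => p.1.1.trans p.1.2.1.symm
  have hstep : ∀ k (p : S k), ∃ q : S (k + 1),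
      (∀ x, dist (H k p x) (H (k + 1) q x) ≤ (4 * C) / 2 / 2 ^ k) ∧
      ∀ x, dist ((H k p).symm x) ((H (k + 1) q).symm x) ≤ (4 * C) / 2 / 2 ^ k := by
    rintro k ⟨⟨A, B, δ⟩, hp⟩
    have hk : 0 < C / 2 ^ (k + 1) := by positivity
    have hkk : C / 2 ^ (k + 1) = C / 2 ^ k / 2 := by rw [pow_succ]; field_simp
    have hk0 : 0 < C / 2 ^ k := by positivity
    have h4 : 4 * C / 2 / 2 ^ k = C / 2 ^ k + C / 2 ^ k := by ring
    obtain ⟨B', δ₁, hs₁, h11, h12⟩ := hp.step hμ hν hk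
    obtain ⟨A', δ₂, hs₂, h21, h22⟩ := hs₁.step hν hμ hk
    refine ⟨⟨⟨A', B', δ₂⟩, hs₂⟩, fun x => ?_, fun x => ?_⟩
    · rw [h4]
      exact (dist_triangle _ _ _).trans (add_le_add (h11 x) (h22 x))
    · rw [h4]
      exact (dist_triangle _ _ _).trans (add_le_add (h12 x)
        ((h21 x).trans (by rw [hkk]; linarith)))
  choose next hnext₁ hnext₂ using hstep
  let s : ∀ k, S k := fun k =>
    Nat.rec ⟨⟨.refl _, .refl _, δ⟩, by simpa using h⟩ (fun k p => next k p) k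
  obtain ⟨g, hg⟩ := exists_homeomorph_limit (fun k => H k (s k)) (4 * C)
    (fun k x => hnext₁ k (s k) x) (fun k x => hnext₂ k (s k) x)
  refine ⟨g, fun x hx => ?_, 4 * C, fun k => ⟨(s k).1.1, (s k).1.2.1, (s k).1.2.2, (s k).2, hg k⟩⟩
  have hfix : ∀ k, H k (s k) x = x := fun k => by
    change (s k).1.2.1.symm ((s k).1.1 x) = x
    rw [(s k).2.suppA x hx, symm_eq_self_of_support (s k).2.suppB x hx]
  have h0 : Tendsto (fun k : ℕ => 4 * C / 2 ^ k) atTop (𝓝 0) := by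
    have := (tendsto_pow_atTop_nhds_zero_of_lt_one (r := (1 / 2 : ℝ)) (by norm_num)
      (by norm_num)).const_mul (4 * C)
    simpa [div_eq_mul_inv] using this
  have hle : dist x (g x) ≤ 0 := ge_of_tendsto' h0 fun k => by
    simpa [hfix k] using hg k x
  exact (dist_le_zero.1 hle).symm

/-- Oxtoby–Ulam theorem: two good measures on a box with equal mass and null boundary are
conjugate by a homeomorphism supported in the box. -/
theorem exists_homeomorph_map_restrict (hμ : IsGoodMeasure μ) (hν : IsGoodMeasure ν)
    (hab : ∀ i, a i < b i) (hmass : μ (Icc a b) = ν (Icc a b))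
    (hμ0 : μ (Icc a b \ openBox a b) = 0) (hν0 : ν (Icc a b \ openBox a b) = 0) :
    ∃ g : (Fin n → ℝ) ≃ₜ (Fin n → ℝ), (∀ x ∉ openBox a b, g x = x) ∧
      (μ.restrict (Icc a b)).map g = ν.restrict (Icc a b) := by
  obtain ⟨d, hd⟩ : ∃ d : ℝ, 0 < d ∧ ∀ i, b i - a i ≤ d := by
    refine ⟨1 + ∑ i, |b i - a i|, by positivity, fun i => ?_⟩
    have := Finset.single_le_sum (f := fun i => |b i - a i|) (fun j _ => abs_nonneg _)
      (Finset.mem_univ i)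
    have h2 := le_abs_self (b i - a i)
    linarith
  have hbase : MatchState μ ν a b (.refl _) (.refl _) d (3 * d) (3 * d) := by
    refine ⟨hd.1, fun _ _ => rfl, fun _ _ => rfl, .leaf hab hd.2 ?_ ?_ ?_, fun u v h => ?_,
      fun u v h => h⟩
    · simpa [map_homeomorph_apply] using hmass
    · simpa [map_homeomorph_apply] using hμ0
    · simpa [map_homeomorph_apply] using hν0
    · exact h.trans (by linarith [hd.1])
  obtain ⟨g, hg, D, hstate⟩ := hbase.exists_homeomorph (by linarith [hd.1]) hμ hν
  refine ⟨g, hg, ?_⟩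
  have : IsFiniteMeasure (μ.restrict (Icc a b)) :=
    ⟨by rw [Measure.restrict_apply_univ]; exact (hμ.compact _ isCompact_Icc).lt_top⟩
  have : IsFiniteMeasure (ν.restrict (Icc a b)) :=
    ⟨by rw [Measure.restrict_apply_univ]; exact (hν.compact _ isCompact_Icc).lt_top⟩
  have hclosed : ∀ K : Set (Fin n → ℝ), IsClosed K →
      (μ.restrict (Icc a b)).map g K ≤ (ν.restrict (Icc a b)) K := by
    intro K hK
    have h0 : Tendsto (fun k : ℕ => (3 * d + D) / 2 ^ k) atTop (𝓝 0) := by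
      have := (tendsto_pow_atTop_nhds_zero_of_lt_one (r := (1 / 2 : ℝ)) (by norm_num)
        (by norm_num)).const_mul (3 * d + D)
      simpa [div_eq_mul_inv] using this
    refine ge_of_tendsto' ((tendsto_measure_cthickening_of_isClosed (μ := ν.restrict (Icc a b))
      ⟨1, one_pos, measure_ne_top _ _⟩ hK).comp h0) fun k => ?_
    obtain ⟨A, B, δ, hs, hdist⟩ := hstate k
    rw [map_homeomorph_apply, Measure.restrict_apply' measurableSet_Icc]
    simp only [comp_apply]
    rw [Measure.restrict_apply' measurableSet_Icc]
    refine (measure_mono ?_).trans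
      ((hs.measure_le {y | ∃ z ∈ K, dist y z ≤ D / 2 ^ k}).trans (measure_mono ?_))
    · rintro x ⟨hx, hxI⟩
      exact ⟨⟨g x, hx, hdist x⟩, hxI⟩
    · rintro x ⟨⟨y, ⟨z, hz, hyz⟩, hxy⟩, hxI⟩
      refine ⟨Metric.mem_cthickening_of_dist_le x z _ K hz ?_, hxI⟩
      rw [add_div]
      exact (dist_triangle _ _ _).trans (add_le_add hxy hyz)
  refine Measure.eq_of_le_of_measure_univ_eq ?_ ?_
  · refine Measure.le_iff.2 fun s hs => ?_
    rw [hs.measure_eq_iSup_isClosed_of_ne_top (measure_ne_top _ _)]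
    exact iSup₂_le fun K hKs => iSup_le fun hK => (hclosed K hK).trans (measure_mono hKs)
  · rw [map_homeomorph_apply, preimage_univ, Measure.restrict_apply_univ,
      Measure.restrict_apply_univ, hmass]

end OxtobyUlam

section Twist

variable {n : ℕ}

/-- Rotation by a unit complex number in the plane of the coordinates `i`, `j`. -/
def planeRotation (i j : Fin n) (c : Circle) : (Fin n → ℝ) →ₗ[ℝ] (Fin n → ℝ) where
  toFun x k :=
    if k = i then (c : ℂ).re * x i - (c : ℂ).im * x j
    else if k = j then (c : ℂ).im * x i + (c : ℂ).re * x j else x k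
  map_add' x y := by
    ext k
    simp only [Pi.add_apply]
    split_ifs <;> ring
  map_smul' r x := by
    ext k
    simp only [Pi.smul_apply, smul_eq_mul, RingHom.id_apply]
    split_ifs <;> ring

theorem planeRotation_apply (i j : Fin n) (c : Circle) (x : Fin n → ℝ) (k : Fin n) :
    planeRotation i j c x k =
      if k = i then (c : ℂ).re * x i - (c : ℂ).im * x j
      else if k = j then (c : ℂ).im * x i + (c : ℂ).re * x j else x k := rfl

theorem planeRotation_one (i j : Fin n) (x : Fin n → ℝ) : planeRotation i j 1 x = x := by
  ext k
  rw [planeRotation_apply]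
  split_ifs with h h' <;> simp [*]

theorem planeRotation_mul {i j : Fin n} (hij : i ≠ j) (c d : Circle) (x : Fin n → ℝ) :
    planeRotation i j (c * d) x = planeRotation i j c (planeRotation i j d x) := by
  ext k
  simp only [planeRotation_apply, if_true, hij.symm, if_false, Circle.coe_mul, Complex.mul_re,
    Complex.mul_im]
  split_ifs <;> ring

theorem continuous_planeRotation (i j : Fin n) :
    Continuous fun p : Circle × (Fin n → ℝ) => planeRotation i j p.1 p.2 := by
  refine continuous_pi fun k => ?_
  simp only [planeRotation_apply]
  split_ifs <;> fun_prop

theorem abs_det_planeRotation {i j : Fin n} (hij : i ≠ j) (c : Circle) :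
    |LinearMap.det (planeRotation i j c)| = 1 := by
  have h1 : LinearMap.det (planeRotation i j c) * LinearMap.det (planeRotation i j c⁻¹) = 1 := by
    rw [← LinearMap.det_comp]
    have h : planeRotation i j c ∘ₗ planeRotation i j c⁻¹ = LinearMap.id := LinearMap.ext fun x => by
      rw [LinearMap.comp_apply, ← planeRotation_mul hij, mul_inv_cancel, planeRotation_one,
        LinearMap.id_apply]
    rw [h, LinearMap.det_id]
  let S := LinearEquiv.funCongrLeft ℝ ℝ (Equiv.swap i j)
  have h2 : LinearMap.det (planeRotation i j c⁻¹) = LinearMap.det (planeRotation i j c) := by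
    rw [← LinearMap.det_conj (planeRotation i j c) S]
    congr 1
    refine LinearMap.ext fun x => funext fun k => ?_
    have hS : ∀ y k, S y k = y (Equiv.swap i j k) := fun _ _ => rfl
    have hS' : ∀ y k, S.symm y k = y (Equiv.swap i j k) := fun _ _ => rfl
    simp only [LinearMap.comp_apply, LinearEquiv.coe_coe, hS, hS', planeRotation_apply,
      Equiv.swap_apply_left, Equiv.swap_apply_right, Circle.coe_inv_eq_conj, Complex.conj_re,
      Complex.conj_im]
    by_cases hi : k = i
    · subst hi
      simp [hij.symm]
      ring
    by_cases hj : k = j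
    · subst hj
      simp [hij.symm]
      ring
    · simp [hi, hj, Equiv.swap_apply_of_ne_of_ne hi hj]
  rw [h2] at h1
  rcases mul_self_eq_one_iff.1 h1 with h | h <;> simp [h]

theorem measurePreserving_planeRotation {i j : Fin n} (hij : i ≠ j) (c : Circle) :
    MeasurePreserving (planeRotation i j c) volume volume := by
  have h := abs_det_planeRotation hij c
  refine ⟨(LinearMap.continuous_of_finiteDimensional _).measurable, ?_⟩
  rw [Real.map_linearMap_volume_pi_eq_smul_volume_pi (by
    intro h0
    simp [h0] at h), abs_inv, h]
  simp

theorem sum_sq_planeRotation {i j : Fin n} (hij : i ≠ j) (c : Circle) (x : Fin n → ℝ) :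
    ∑ k, planeRotation i j c x k ^ 2 = ∑ k, x k ^ 2 := by
  have hc : (c : ℂ).re * (c : ℂ).re + (c : ℂ).im * (c : ℂ).im = 1 := by
    rw [← Complex.normSq_apply, Circle.normSq_coe]
  rw [← Finset.add_sum_erase _ _ (Finset.mem_univ i), ← Finset.add_sum_erase _ (fun k => x k ^ 2)
    (Finset.mem_univ i), ← Finset.add_sum_erase _ _ (Finset.mem_erase.2 ⟨hij.symm,
    Finset.mem_univ j⟩), ← Finset.add_sum_erase _ (fun k => x k ^ 2) (Finset.mem_erase.2 ⟨hij.symm,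
    Finset.mem_univ j⟩), Finset.sum_congr rfl (g := fun k => x k ^ 2)]
  · simp only [planeRotation_apply, if_true, hij.symm, if_false]
    linear_combination (x i ^ 2 + x j ^ 2) * hc
  · intro k hk
    simp only [Finset.mem_erase] at hk
    simp [planeRotation_apply, hk.1, hk.2.1]

/-- Rotation by an angle that is a function of the distance to the origin, vanishing off the
unit ball. -/
noncomputable def twist (i j : Fin n) (s : ℝ) (x : Fin n → ℝ) : Fin n → ℝ :=
  planeRotation i j (Circle.exp (s * max 0 (1 - ∑ k, x k ^ 2))) x

theorem continuous_twist (i j : Fin n) : Continuous (uncurry (twist i j)) :=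
  (continuous_planeRotation i j).comp (f := fun p : ℝ × (Fin n → ℝ) =>
    (Circle.exp (p.1 * max 0 (1 - ∑ k, p.2 k ^ 2)), p.2)) (by fun_prop)

theorem twist_planeRotation {i j : Fin n} (hij : i ≠ j) (s : ℝ) (c : Circle) (x : Fin n → ℝ) :
    twist i j s (planeRotation i j c x) =
      planeRotation i j (Circle.exp (s * max 0 (1 - ∑ k, x k ^ 2)) * c) x := by
  rw [twist, sum_sq_planeRotation hij, planeRotation_mul hij]

theorem twist_neg {i j : Fin n} (hij : i ≠ j) (s : ℝ) (x : Fin n → ℝ) :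
    twist i j s (twist i j (-s) x) = x := by
  rw [twist, ← twist, twist.eq_def i j (-s), twist_planeRotation hij, ← Circle.exp_add]
  simp [planeRotation_one]

theorem measurePreserving_twist {i j : Fin n} (hij : i ≠ j) (s : ℝ) :
    MeasurePreserving (twist i j s) volume volume := by
  let _ : MeasurableSpace Circle := borel Circle
  have : BorelSpace Circle := ⟨rfl⟩
  obtain ⟨η, _, _⟩ : ∃ η : Measure Circle, IsProbabilityMeasure η ∧ η.IsMulLeftInvariant :=
    ⟨Measure.haarMeasure ⊤, ⟨Measure.haarMeasure_self⟩, inferInstance⟩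
  have hrot : MeasurePreserving (fun p : Circle × (Fin n → ℝ) => planeRotation i j p.1 p.2)
      (η.prod volume) volume :=
    measurePreserving_snd.comp ((MeasurePreserving.id η).skew_product
      (continuous_planeRotation i j).measurable
      (Eventually.of_forall fun c => (measurePreserving_planeRotation hij c).map_eq))
  have hm : MeasurePreserving (fun p : (Fin n → ℝ) × Circle => planeRotation i j p.2 p.1)
      (volume.prod η) volume := hrot.comp Measure.measurePreserving_swap
  let g : (Fin n → ℝ) → Circle → Circle := fun x c => Circle.exp (s * max 0 (1 - ∑ k, x k ^ 2)) * c
  have hg : Measurable (uncurry g) := by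
    have : Continuous (uncurry g) := by
      unfold uncurry
      fun_prop
    exact this.measurable
  have hS : MeasurePreserving (fun p : (Fin n → ℝ) × Circle => (p.1, g p.1 p.2))
      ((volume : Measure (Fin n → ℝ)).prod η) (volume.prod η) :=
    (MeasurePreserving.id volume).skew_product hg
      (Eventually.of_forall fun x => (measurePreserving_mul_left η _).map_eq)
  have hT : Measurable (twist i j s) :=
    ((continuous_twist i j).comp (f := fun x => (s, x)) (by fun_prop)).measurable
  refine ⟨hT, ?_⟩
  conv_lhs => rw [← hm.map_eq]
  rw [Measure.map_map hT hm.measurable]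
  refine Eq.trans ?_ (hm.comp hS).map_eq
  congr 1
  ext1 p
  exact twist_planeRotation hij s p.2 p.1

/-- A continuous family `T` of measure preserving homeomorphisms, parametrised by the reals and
starting at the identity, which fails to be equicontinuous. -/
structure IsWildFlow {M : Type*} [TopologicalSpace M] [MeasurableSpace M] (μ : Measure M)
    (T : ℝ → M → M) : Prop where
  continuous : Continuous (uncurry T)
  zero : ∀ x, T 0 x = x
  neg : ∀ s x, T s (T (-s) x) = x
  measurePreserving : ∀ s, MeasurePreserving (T s) μ μ
  wild : ∃ (x z : M) (u : ℕ → M), x ≠ z ∧ (∀ s, T s x = x) ∧ Tendsto u atTop (𝓝 x) ∧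
    Tendsto (fun k : ℕ => T k (u k)) atTop (𝓝 z)

theorem twist_eq_self {i j : Fin n} (s : ℝ) {x : Fin n → ℝ} (hx : 1 ≤ ∑ k, x k ^ 2) :
    twist i j s x = x := by
  rw [twist, max_eq_left (by linarith), mul_zero, Circle.exp_zero, planeRotation_one]

theorem sum_single_sq (i : Fin n) (r : ℝ) : ∑ k, (Pi.single i r : Fin n → ℝ) k ^ 2 = r ^ 2 := by
  rw [Finset.sum_eq_single i] <;> simp +contextual

theorem isWildFlow_twist {i j : Fin n} (hij : i ≠ j) : IsWildFlow volume (twist i j) where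
  continuous := continuous_twist i j
  zero x := by simp [twist, planeRotation_one]
  neg := twist_neg hij
  measurePreserving := measurePreserving_twist hij
  wild := by
    have hr : Tendsto (fun k : ℕ => √(1 - Real.pi / k)) atTop (𝓝 1) := by
      have := ((tendsto_const_div_atTop_nhds_zero_nat Real.pi).const_sub 1).sqrt
      simpa using this
    have hsingle : Continuous fun r : ℝ => (Pi.single i r : Fin n → ℝ) :=
      continuous_single (A := fun _ : Fin n => ℝ) i
    refine ⟨Pi.single i 1, Pi.single i (-1), fun k => Pi.single i √(1 - Real.pi / k), ?_,
      fun s => twist_eq_self s (by rw [sum_single_sq]; norm_num), ?_, ?_⟩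
    · intro h
      have := congrFun h i
      norm_num at this
    · exact (hsingle.tendsto 1).comp hr
    · refine ((hsingle.tendsto (-1)).comp hr.neg).congr' ?_
      filter_upwards [eventually_ge_atTop 4] with k hk
      have hk' : (4 : ℝ) ≤ k := by exact_mod_cast hk
      have hle : Real.pi / k ≤ 1 := (div_le_one (by linarith)).2 (by linarith [Real.pi_le_four])
      have hpos : 0 ≤ Real.pi / k := by positivity
      have hang : (k : ℝ) * max 0 (1 - (1 - Real.pi / k)) = Real.pi := by
        rw [sub_sub_cancel, max_eq_right hpos, mul_div_cancel₀]
        linarith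
      rw [twist, sum_single_sq, Real.sq_sqrt (by linarith), hang]
      ext l
      simp only [comp_apply, planeRotation_apply, Circle.coe_exp, Pi.single_apply]
      simp only [Complex.exp_pi_mul_I]
      by_cases hl : l = i <;> simp [hl, hij.symm]

theorem twist_eq_self_of_notMem {i j : Fin n} (s : ℝ) {x : Fin n → ℝ}
    (hx : x ∉ openBox (fun _ => -1) (fun _ => 1)) : twist i j s x = x := by
  refine twist_eq_self s ?_
  simp only [mem_openBox, not_forall] at hx
  obtain ⟨k, hk⟩ := hx
  have h1 : 1 ≤ x k ^ 2 := by
    by_contra! h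
    exact hk (abs_lt.1 ((sq_lt_one_iff_abs_lt_one _).1 h))
  exact h1.trans (Finset.single_le_sum (f := fun k => x k ^ 2) (fun _ _ => sq_nonneg _)
    (Finset.mem_univ k))

end Twist

theorem map_eq_self_of_map_restrict {M : Type*} [MeasurableSpace M] {μ : Measure M} {f : M → M}
    (hf : Measurable f) {Q : Set M} (hQ : MeasurableSet Q) (hfQ : ∀ x ∉ Q, f x = x)
    (h : (μ.restrict Q).map f = μ.restrict Q) : μ.map f = μ := by
  conv_lhs => rw [← Measure.restrict_add_restrict_compl (μ := μ) hQ]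
  rw [Measure.map_add _ _ hf, h, Measure.map_congr (g := id), Measure.map_id,
    Measure.restrict_add_restrict_compl hQ]
  filter_upwards [ae_restrict_mem hQ.compl] with x hx using hfQ x hx

section GoodMeasure

variable {n : ℕ}

theorem IsGoodMeasure.exists_null_box {m : Measure (Fin n → ℝ)} (hm : IsGoodMeasure m) :
    ∃ a b : Fin n → ℝ, (∀ i, a i < -1) ∧ (∀ i, 1 < b i) ∧ m (Icc a b \ openBox a b) = 0 := by
  choose a ha ha' ham using fun i => hm.exists_level_null (fun _ => -2) (fun _ => 2) i
    (show (-2 : ℝ) < -1 by norm_num)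
  choose b hb hb' hbm using fun i => hm.exists_level_null (fun _ => -2) (fun _ => 2) i
    (show (1 : ℝ) < 2 by norm_num)
  refine ⟨a, b, ha', hb, measure_mono_null (t := ⋃ i,
    (Icc (fun _ => -2) (fun _ => 2) ∩ {x | x i = a i}) ∪
    (Icc (fun _ => -2) (fun _ => 2) ∩ {x | x i = b i})) (fun x hx => ?_)
    (measure_iUnion_null fun i => measure_union_null (ham i) (hbm i))⟩
  have hx2 : x ∈ Icc (fun _ => -2 : Fin n → ℝ) (fun _ => 2) :=
    ⟨fun i => (ha i).le.trans (hx.1.1 i), fun i => (hx.1.2 i).trans (hb' i).le⟩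
  have hx' := hx.2
  simp only [mem_openBox, not_forall] at hx'
  obtain ⟨i, hi⟩ := hx'
  refine mem_iUnion.2 ⟨i, ?_⟩
  rcases (hx.1.1 i).eq_or_lt with h | h
  · exact Or.inl ⟨hx2, h.symm⟩
  · exact Or.inr ⟨hx2, (hx.1.2 i).eq_of_not_lt fun h' => hi ⟨h, h'⟩⟩

theorem isGoodMeasure_smul_volume (hn : 0 < n) {c : ENNReal} (hc : c ≠ 0) (hc' : c ≠ ⊤) :
    IsGoodMeasure (c • (volume : Measure (Fin n → ℝ))) where
  singleton x := by
    have : Nonempty (Fin n) := ⟨⟨0, hn⟩⟩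
    rw [Measure.smul_apply, measure_singleton, smul_zero]
  pos U hU hne := by
    rw [Measure.smul_apply, smul_eq_mul]
    exact ENNReal.mul_pos hc (hU.measure_pos volume hne).ne'
  compact K hK := by
    rw [Measure.smul_apply, smul_eq_mul]
    exact ENNReal.mul_ne_top hc' hK.measure_lt_top.ne

theorem volume_Icc_diff_openBox (a b : Fin n → ℝ) :
    volume (Icc a b \ openBox a b) = 0 := by
  have h : openBox a b =ᵐ[volume] Icc a b := Measure.univ_pi_Ioo_ae_eq_Icc
  exact ae_le_set.1 h.symm.le

/-- Every good measure on `ℝⁿ`, `n ≥ 2`, is preserved by a wild flow with compact support. -/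
theorem IsGoodMeasure.exists_isWildFlow (hn : 2 ≤ n) {m : Measure (Fin n → ℝ)}
    (hm : IsGoodMeasure m) : ∃ (K : Set (Fin n → ℝ)) (T : ℝ → (Fin n → ℝ) → Fin n → ℝ),
      IsCompact K ∧ IsWildFlow m T ∧ ∀ s, ∀ x ∉ K, T s x = x := by
  obtain ⟨a, b, ha, hb, hab0⟩ := hm.exists_null_box
  have hab : ∀ i, a i < b i := fun i => by linarith [ha i, hb i]
  have hv : IsGoodMeasure (volume : Measure (Fin n → ℝ)) := by
    simpa using isGoodMeasure_smul_volume (by omega) one_ne_zero ENNReal.one_ne_top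
  have hv0 := (hv.Icc_pos hab).ne'
  have hvt := hv.compact _ (isCompact_Icc (a := a) (b := b))
  have hm0 := (hm.Icc_pos hab).ne'
  have hmt := hm.compact _ (isCompact_Icc (a := a) (b := b))
  set c : ENNReal := m (Icc a b) / volume (Icc a b) with hc
  obtain ⟨h, hsupp, hmap⟩ := exists_homeomorph_map_restrict hm
    (isGoodMeasure_smul_volume (by omega) (ENNReal.div_ne_zero.2 ⟨hm0, hvt⟩)
      (ENNReal.div_ne_top hmt hv0)) hab
    (by rw [Measure.smul_apply, smul_eq_mul, ENNReal.div_mul_cancel hv0 hvt]) hab0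
    (by rw [Measure.smul_apply, volume_Icc_diff_openBox, smul_zero])
  have hij : (⟨0, by omega⟩ : Fin n) ≠ ⟨1, by omega⟩ := by simp
  obtain ⟨T, hT, hTs⟩ : ∃ T : ℝ → (Fin n → ℝ) → Fin n → ℝ, IsWildFlow volume T ∧
      ∀ s, ∀ x ∉ openBox a b, T s x = x :=
    ⟨_, isWildFlow_twist hij, fun s x hx => twist_eq_self_of_notMem s fun hx' => hx
      (mem_openBox.2 fun i => ⟨(ha i).trans (mem_openBox.1 hx' i).1,
        (mem_openBox.1 hx' i).2.trans (hb i)⟩)⟩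
  have hcont : Continuous (uncurry fun s x => h.symm (T s (h x))) :=
    h.symm.continuous.comp (hT.continuous.comp (f := fun p : ℝ × (Fin n → ℝ) => (p.1, h p.2))
      (by fun_prop))
  have hcont' : ∀ s, Continuous fun x => h.symm (T s (h x)) := fun s =>
    hcont.comp (f := fun x => (s, x)) (by fun_prop)
  have hsupp' : ∀ s, ∀ x ∉ openBox a b, h.symm (T s (h x)) = x := fun s x hx => by
    rw [hsupp x hx, hTs s x hx, h.symm_apply_eq, hsupp x hx]
  have hpre : ∀ s, T s ⁻¹' Icc a b = Icc a b := fun s => by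
    have key : ∀ s, ∀ x ∈ Icc a b, T s x ∈ Icc a b := fun s x hx => by
      by_contra hn
      have h1 := hT.neg (-s) x
      rw [neg_neg, hTs (-s) _ fun h' => hn (openBox_subset_Icc a b h')] at h1
      exact hn (h1.symm ▸ hx)
    refine Subset.antisymm (fun x hx => ?_) (key s)
    have h1 := key (-s) _ hx
    have h2 := hT.neg (-s) x
    rw [neg_neg] at h2
    rwa [h2] at h1
  refine ⟨Icc a b, fun s x => h.symm (T s (h x)), isCompact_Icc, ⟨hcont, fun x => ?_, fun s x => ?_,
    fun s => ⟨(hcont' s).measurable, ?_⟩, ?_⟩,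
    fun s x hx => hsupp' s x fun h' => hx (openBox_subset_Icc a b h')⟩
  · simp [hT.zero]
  · simp [hT.neg]
  · refine map_eq_self_of_map_restrict (hcont' s).measurable measurableSet_Icc
      (fun x hx => hsupp' s x fun h' => hx (openBox_subset_Icc a b h')) ?_
    have h1 := ((hT.measurePreserving s).smul_measure c).restrict_preimage
      (measurableSet_Icc (a := a) (b := b))
    rw [hpre] at h1
    have h2 : MeasurePreserving h (m.restrict (Icc a b)) ((c • volume).restrict (Icc a b)) :=
      ⟨h.continuous.measurable, hmap⟩
    have h3 : MeasurePreserving h.symm ((c • volume).restrict (Icc a b)) (m.restrict (Icc a b)) :=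
      MeasurePreserving.symm h.toMeasurableEquiv h2
    exact (h3.comp (h1.comp h2)).map_eq
  · obtain ⟨x, z, u, hxz, hx, hu, hz⟩ := hT.wild
    refine ⟨h.symm x, h.symm z, fun k => h.symm (u k), h.symm.injective.ne hxz, fun s => ?_,
      (h.symm.continuous.tendsto x).comp hu, ?_⟩
    · simp [hx]
    · simpa [comp_def] using (h.symm.continuous.tendsto z).comp hz

end GoodMeasure

section Manifold

variable {n : ℕ} {M : Type*} [TopologicalSpace M]

theorem exists_isOpenEmbedding_of_chart (hM : ∀ x : M, ∃ U : Set M, IsOpen U ∧ x ∈ U ∧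
      ∃ V : Set (Fin n → ℝ), IsOpen V ∧ Nonempty (↥U ≃ₜ ↥V)) {O : Set M} (hO : IsOpen O)
    (hne : O.Nonempty) : ∃ j : (Fin n → ℝ) → M, IsOpenEmbedding j ∧ range j ⊆ O := by
  obtain ⟨x, hx⟩ := hne
  obtain ⟨U, hU, hxU, V, hV, ⟨e⟩⟩ := hM x
  have hj : IsOpenEmbedding (fun v : V => (e.symm v : M)) :=
    hU.isOpenEmbedding_subtypeVal.comp e.symm.isOpenEmbedding
  obtain ⟨W, hW, hWO⟩ := isOpen_induced_iff.1 (hO.preimage hj.continuous)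
  have hxW : (e ⟨x, hxU⟩ : Fin n → ℝ) ∈ W ∩ V := by
    refine ⟨?_, (e ⟨x, hxU⟩).2⟩
    have : e ⟨x, hxU⟩ ∈ Subtype.val ⁻¹' W := by
      rw [hWO]
      simpa using hx
    exact this
  obtain ⟨r, hr, hball⟩ := Metric.isOpen_iff.1 (hW.inter hV) _ hxW
  obtain ⟨u, hu, hur⟩ : ∃ u : (Fin n → ℝ) → Fin n → ℝ, IsOpenEmbedding u ∧ range u ⊆ W ∩ V := by
    have hs := OpenPartialHomeomorph.univBall_source (e ⟨x, hxU⟩ : Fin n → ℝ) r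
    refine ⟨_, (OpenPartialHomeomorph.univBall (e ⟨x, hxU⟩ : Fin n → ℝ) r).isOpenEmbedding hs, ?_⟩
    rw [← image_univ, ← hs, OpenPartialHomeomorph.image_source_eq_target,
      OpenPartialHomeomorph.univBall_target _ hr]
    exact hball
  have hmem : ∀ y, u y ∈ V := fun y => (hur ⟨y, rfl⟩).2
  have hcod : IsOpenEmbedding (codRestrict u V hmem) :=
    .of_comp _ hV.isOpenEmbedding_subtypeVal hu
  refine ⟨_, hj.comp hcod, ?_⟩
  rintro _ ⟨y, rfl⟩
  have : codRestrict u V hmem y ∈ Subtype.val ⁻¹' W := (hur ⟨y, rfl⟩).1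
  rw [hWO] at this
  exact this

theorem locallyCompactSpace_of_chart (hM : ∀ x : M, ∃ U : Set M, IsOpen U ∧ x ∈ U ∧
      ∃ V : Set (Fin n → ℝ), IsOpen V ∧ Nonempty (↥U ≃ₜ ↥V)) : LocallyCompactSpace M := by
  refine ⟨fun x O hO => ?_⟩
  obtain ⟨U, hU, hxU, V, hV, ⟨e⟩⟩ := hM x
  have : LocallyCompactSpace V := hV.locallyCompactSpace
  have : LocallyCompactSpace U := e.isClosedEmbedding.locallyCompactSpace
  obtain ⟨K, hK, hKO, hKc⟩ := local_compact_nhds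
    (continuous_subtype_val.continuousAt.preimage_mem_nhds hO : Subtype.val ⁻¹' O ∈ 𝓝 (⟨x, hxU⟩ : U))
  exact ⟨_, hU.isOpenEmbedding_subtypeVal.image_mem_nhds.2 hK, image_subset_iff.2 hKO,
    hKc.image continuous_subtype_val⟩

variable [MeasurableSpace M] [BorelSpace M]

theorem IsGoodMeasure.comap {E : Type*} [TopologicalSpace E] [MeasurableSpace E] [BorelSpace E]
    {μ : Measure M} (hμ : IsGoodMeasure μ) {j : E → M}
    (hj : IsOpenEmbedding j) : IsGoodMeasure (μ.comap j) where
  singleton x := by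
    rw [hj.measurableEmbedding.comap_apply, image_singleton, hμ.singleton]
  pos U hU hne := by
    rw [hj.measurableEmbedding.comap_apply]
    exact hμ.pos _ (hj.isOpenMap U hU) (hne.image j)
  compact K hK := by
    rw [hj.measurableEmbedding.comap_apply]
    exact hμ.compact _ (hK.image hj.continuous)

/-- A compactly supported wild flow extends by the identity along an open embedding. -/
theorem IsWildFlow.exists_extend [T2Space M] {E : Type*} [TopologicalSpace E] [MeasurableSpace E]
    [BorelSpace E] {μ : Measure M} {j : E → M} (hj : IsOpenEmbedding j) {T : ℝ → E → E}
    (hT : IsWildFlow (μ.comap j) T) {K : Set E} (hK : IsCompact K)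
    (hTK : ∀ s, ∀ x ∉ K, T s x = x) :
    ∃ F : ℝ → M → M, IsWildFlow μ F ∧ ∀ s, ∀ x, F s x = x ∨ x ∈ range j ∧ F s x ∈ range j := by
  classical
  let F : ℝ → M → M := fun s => extend j (fun y => j (T s y)) id
  have hFj : ∀ s y, F s (j y) = j (T s y) := fun s y => hj.injective.extend_apply _ _ _
  have hFo : ∀ s, ∀ x ∉ range j, F s x = x := fun s x hx => extend_apply' _ _ _ hx
  have hFK : ∀ s, ∀ x ∉ j '' K, F s x = x := fun s x hx => by
    by_cases h : x ∈ range j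
    · obtain ⟨y, rfl⟩ := h
      rw [hFj, hTK s y fun h => hx ⟨y, h, rfl⟩]
    · exact hFo s x h
  have hcont : Continuous (uncurry F) := by
    refine continuous_iff_continuousAt.2 fun ⟨s, x⟩ => ?_
    by_cases h : x ∈ range j
    · obtain ⟨y, rfl⟩ := h
      have hidj : IsOpenEmbedding (Prod.map (id : ℝ → ℝ) j) := IsOpenEmbedding.id.prodMap hj
      refine (hidj.continuousAt_iff (x := (s, y))).1 ?_
      have : uncurry F ∘ Prod.map id j = fun p => j (uncurry T p) := funext fun p => hFj p.1 p.2
      rw [this]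
      exact (hj.continuous.comp hT.continuous).continuousAt
    · have ho : IsOpen (Prod.snd ⁻¹' (j '' K)ᶜ : Set (ℝ × M)) :=
        (hK.image hj.continuous).isClosed.isOpen_compl.preimage continuous_snd
      refine continuousAt_snd.congr ?_
      filter_upwards [ho.mem_nhds (fun h' => h (image_subset_range j K h'))] with p hp
      exact (hFK p.1 p.2 hp).symm
  have hFm : ∀ s, Measurable (F s) := fun s =>
    (hcont.comp (f := fun x => (s, x)) (by fun_prop)).measurable
  refine ⟨F, ⟨hcont, fun x => ?_, fun s x => ?_, fun s => ⟨hFm s, ?_⟩, ?_⟩, fun s x => ?_⟩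
  · by_cases h : x ∈ range j
    · obtain ⟨y, rfl⟩ := h
      rw [hFj, hT.zero]
    · exact hFo _ x h
  · by_cases h : x ∈ range j
    · obtain ⟨y, rfl⟩ := h
      rw [hFj, hFj, hT.neg]
    · rw [hFo _ x h, hFo _ x h]
  · refine map_eq_self_of_map_restrict (hFm s) hj.isOpen_range.measurableSet (hFo s) ?_
    have h1 := hT.measurePreserving s
    rw [← hj.measurableEmbedding.map_comap, Measure.map_map (hFm s) hj.continuous.measurable]
    have : F s ∘ j = j ∘ T s := funext (hFj s)
    rw [this, ← Measure.map_map hj.continuous.measurable h1.measurable, h1.map_eq]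
  · obtain ⟨x, z, u, hxz, hx, hu, hz⟩ := hT.wild
    refine ⟨j x, j z, fun k => j (u k), hj.injective.ne hxz, fun s => ?_,
      (hj.continuous.tendsto x).comp hu, ?_⟩
    · rw [hFj, hx]
    · simpa [hFj, comp_def] using (hj.continuous.tendsto z).comp hz
  · by_cases h : x ∈ range j
    · obtain ⟨y, rfl⟩ := h
      exact Or.inr ⟨⟨y, rfl⟩, ⟨_, (hFj s y).symm⟩⟩
    · exact Or.inl (hFo s x h)

end Manifold

/-- A wild flow fixing `X` pointwise stays in the identity component. -/
theorem IsWildFlow.mem_MPHomeoFixIdComp {M : Type*} [TopologicalSpace M] [MeasurableSpace M]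
    {μ : Measure M} {X : Set M} {F : ℝ → M → M} (hF : IsWildFlow μ F)
    (hX : ∀ s, ∀ x ∈ X, F s x = x) (s : ℝ) :
    ContinuousMap.curry ⟨uncurry F, hF.continuous⟩ s ∈ MPHomeoFixIdComp M X μ := by
  set c : C(ℝ, C(M, M)) := ContinuousMap.curry ⟨uncurry F, hF.continuous⟩
  have hc : ∀ s x, c s x = F s x := fun _ _ => rfl
  have h0 : c 0 = ContinuousMap.id M := ContinuousMap.ext fun x => hF.zero x
  refine (isPreconnected_range c.continuous).subset_connectedComponentIn ⟨0, h0⟩ ?_ ⟨s, rfl⟩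
  rintro _ ⟨t, rfl⟩
  refine ⟨Homeomorph.isHomeomorph (⟨⟨c t, c (-t), fun x => ?_, fun x => ?_⟩, (c t).continuous,
    (c (-t)).continuous⟩ : M ≃ₜ M), hX t, (hF.measurePreserving t).map_eq⟩
  · simpa [hc] using hF.neg (-t) x
  · exact hF.neg t x

theorem not_isCompact_of_isWildFlow {M : Type*} [TopologicalSpace M] [LocallyCompactSpace M]
    [T2Space M] [MeasurableSpace M] {μ : Measure M} {F : ℝ → M → M} (hF : IsWildFlow μ F)
    {K : Set C(M, M)} (hFK : ∀ s, ContinuousMap.curry ⟨uncurry F, hF.continuous⟩ s ∈ K) :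
    ¬ IsCompact K := by
  intro hK
  obtain ⟨x, z, u, hxz, hx, hu, hz⟩ := hF.wild
  set c : C(ℝ, C(M, M)) := ContinuousMap.curry ⟨uncurry F, hF.continuous⟩
  have hc : ∀ s x, c s x = F s x := fun _ _ => rfl
  obtain ⟨f, -, hf⟩ := hK.ultrafilter_le_nhds ((hyperfilter ℕ).map fun k : ℕ => c k)
    (le_principal_iff.2 (mem_map.2 (univ_mem' fun k : ℕ => hFK k)))
  have hf' : Tendsto (fun k : ℕ => c k) (hyperfilter ℕ) (𝓝 f) := hf
  have hle : (hyperfilter ℕ : Filter ℕ) ≤ atTop := Nat.hyperfilter_le_atTop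
  have h1 : Tendsto (fun k : ℕ => c k x) (hyperfilter ℕ) (𝓝 (f x)) :=
    ((ContinuousEval.continuous_eval (F := C(M, M))).tendsto (f, x)).comp
      (hf'.prodMk_nhds tendsto_const_nhds)
  have h2 : Tendsto (fun k : ℕ => c k (u k)) (hyperfilter ℕ) (𝓝 (f x)) :=
    ((ContinuousEval.continuous_eval (F := C(M, M))).tendsto (f, x)).comp
      (hf'.prodMk_nhds (hu.mono_left hle))
  simp only [hc, hx] at h1 h2
  exact hxz ((tendsto_nhds_unique tendsto_const_nhds h1).trans
    (tendsto_nhds_unique h2 (hz.mono_left hle)))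

theorem stmt16 (n : ℕ) (hn : 2 ≤ n)
    (M : Type*) [TopologicalSpace M] [MeasurableSpace M] [BorelSpace M]
    [ConnectedSpace M] [SeparableSpace M] [MetrizableSpace M]
    -- `M` is an `n`-manifold without boundary:
    (hM : ∀ x : M, ∃ U : Set M, IsOpen U ∧ x ∈ U ∧
      ∃ V : Set (Fin n → ℝ), IsOpen V ∧ Nonempty (↥U ≃ₜ ↥V))
    (X : Set M) (hX : IsClosed X) (hXne : X ≠ Set.univ)
    -- `μ` is a good Radon measure on `M`:
    (μ : Measure M) [IsFiniteMeasureOnCompacts μ]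
    (hatom : ∀ p : M, μ {p} = 0)
    (hpos : ∀ U : Set M, IsOpen U → U.Nonempty → 0 < μ U) :
    ¬ LocallyCompactSpace ↥(MPHomeoFixIdComp M X μ) := by
  intro hlc
  let _ : MetricSpace M := metrizableSpaceMetric M
  have : LocallyCompactSpace M := locallyCompactSpace_of_chart hM
  have hμ : IsGoodMeasure μ := ⟨hatom, hpos, fun K hK => hK.measure_lt_top.ne⟩
  have hid : ContinuousMap.id M ∈ MPHomeoFixIdComp M X μ :=
    mem_connectedComponentIn ⟨(Homeomorph.refl M).isHomeomorph, fun _ _ => rfl, Measure.map_id⟩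
  obtain ⟨K, hK, hKid⟩ := exists_compact_mem_nhds (⟨_, hid⟩ : MPHomeoFixIdComp M X μ)
  obtain ⟨W, hW, hWK⟩ := mem_nhds_subtype _ _ _ |>.1 hKid
  obtain ⟨V, hV, hVW⟩ := UniformSpace.mem_nhds_iff.1 hW
  obtain ⟨⟨C, D⟩, ⟨-, hD⟩, hCD⟩ := ContinuousMap.hasBasis_compactConvergenceUniformity.mem_iff.1 hV
  obtain ⟨ε, hε, hεD⟩ := Metric.mem_uniformity_dist.1 hD
  obtain ⟨p, hp⟩ := (ne_univ_iff_exists_notMem X).1 hXne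
  obtain ⟨j, hj, hjO⟩ := exists_isOpenEmbedding_of_chart hM
    (Metric.isOpen_ball.inter hX.isOpen_compl) ⟨p, Metric.mem_ball_self (half_pos hε), hp⟩
  obtain ⟨Q, T, hQ, hT, hTQ⟩ := (hμ.comap hj).exists_isWildFlow hn
  obtain ⟨F, hF, hFj⟩ := hT.exists_extend hj hQ hTQ
  have hFX : ∀ s, ∀ x ∈ X, F s x = x := fun s x hx =>
    (hFj s x).resolve_right fun h => (hjO h.1).2 hx
  refine not_isCompact_of_isWildFlow hF (fun s => ?_) (hK.image continuous_subtype_val)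
  refine ⟨⟨_, hF.mem_MPHomeoFixIdComp hFX s⟩, hWK (hVW (hCD fun x _ => hεD ?_)), rfl⟩
  change dist x (F s x) < ε
  rcases hFj s x with h | h
  · rwa [h, dist_self]
  · linarith [dist_triangle_right x (F s x) p, Metric.mem_ball.1 (hjO h.1).1,
      Metric.mem_ball.1 (hjO h.2).1]
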